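/- arXiv:2006.06774 — 3 statements merged into one kernel-verified Lean document; each statement's English description precedes it below -/
import Mathlib

section
/- Let Σ_A ⊆ Σ be an aperiodic and irreducible subshift of finite type and let (φ_i)_{i∈ℕ} be a sequence of continuous potentials φ_i : Σ_A → ℝ with uniformly decreasing variations. Assume that the limit A(𝐢) = lim_{n→∞} (1/n) Σ_{k=0}^{n−1} φ_k(σ^k 𝐢) takes at least two distinct values (that is, the domain of α ↦ h_top(L_A(α)) is a nontrivial interval). Let D = {𝐢 ∈ Σ_A : lim_{n→∞} (1/n) Σ_{k=0}^{n−1} φ_k(σ^k 𝐢) does not exist}. Then h_top(D) = h_top(Σ_A). -/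
open Filter Set
open scoped ENNReal

/-- The left shift on one-sided sequence spaces. -/
def shift {α : Type*} (x : ℕ → α) : ℕ → α := fun n => x (n + 1)

/-- The cylinder set determined by a finite word `w`. -/
def cyl {α : Type*} {n : ℕ} (w : Fin n → α) : Set (ℕ → α) :=
  {x | ∀ k : Fin n, x (k : ℕ) = w k}

/-- Finite words over `α`, encoded with their length. -/
def Word (α : Type*) : Type _ := Σ n : ℕ, Fin n → α

/-- The length (level) of a word/cylinder. -/
def Word.len {α : Type*} (w : Word α) : ℕ := w.1

/-- The cylinder set of a word. -/
def Word.cylSet {α : Type*} (w : Word α) : Set (ℕ → α) := cyl w.2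

/-- `H^s_r(E)`: infimum over covers of `E` by cylinders of level `> r` of
`∑ e^{-s·l(C)}`. -/
noncomputable def Hsr {α : Type*} (E : Set (ℕ → α)) (s : ℝ) (r : ℕ) : ℝ≥0∞ :=
  ⨅ (S : Set (Word α)) (_ : ∀ w ∈ S, r < w.len) (_ : E ⊆ ⋃ w ∈ S, w.cylSet),
    ∑' w : S, ENNReal.ofReal (Real.exp (-s * ((w : Word α).len : ℝ)))

/-- `H^s(E) = lim_{r→∞} H^s_r(E)` (the quantities are nondecreasing in `r`). -/
noncomputable def Hentm {α : Type*} (E : Set (ℕ → α)) (s : ℝ) : ℝ≥0∞ :=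
  ⨆ r : ℕ, Hsr E s r

open scoped Classical in
/-- Topological entropy of `E ⊆ Σ`, with the convention `htop ∅ = -∞`. -/
noncomputable def htop {α : Type*} (E : Set (ℕ → α)) : EReal :=
  if E = ∅ then ⊥ else ((sInf {s : ℝ | 0 ≤ s ∧ Hentm E s ≠ ⊤} : ℝ) : EReal)

/-- The subshift of finite type determined by the 0-1 (Boolean) matrix `M`. -/
def SigmaA {K : ℕ} (M : Fin K → Fin K → Bool) : Set (ℕ → Fin K) :=
  {x | ∀ k : ℕ, M (x k) (x (k + 1)) = true}

/-- `Σ_A` is aperiodic and irreducible: some power of the adjacency matrix is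
strictly positive, i.e. there is `r ≥ 1` such that any two symbols are joined
by an admissible path of length `r`. -/
def ApIrr {K : ℕ} (M : Fin K → Fin K → Bool) : Prop :=
  ∃ r : ℕ, 0 < r ∧ ∀ i j : Fin K, ∃ p : ℕ → Fin K, p 0 = i ∧ p r = j ∧
    ∀ k < r, M (p k) (p (k + 1)) = true

/-- The (non-autonomous) Birkhoff average `(1/n) ∑_{k<n} φ_k(σ^k x)`. -/
noncomputable def birk {K : ℕ} (φ : ℕ → (ℕ → Fin K) → ℝ) (n : ℕ) (x : ℕ → Fin K) : ℝ :=
  (∑ k ∈ Finset.range n, φ k (shift^[k] x)) / n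

/-- The sequence of potentials `φ` has uniformly decreasing variations on `Σ_A`:
`ρ_n := sup_i sup_{|𝐢|=n} sup_{𝐣,𝐤 ∈ [𝐢]} |φ_i(𝐣) - φ_i(𝐤)| → 0`. -/
def UDV {K : ℕ} (M : Fin K → Fin K → Bool) (φ : ℕ → (ℕ → Fin K) → ℝ) : Prop :=
  ∀ ε > (0 : ℝ), ∃ N : ℕ, ∀ n ≥ N, ∀ i : ℕ, ∀ x ∈ SigmaA M, ∀ y ∈ SigmaA M,
    (∀ k < n, x k = y k) → |φ i x - φ i y| < ε

/-- `L_A(α,β)`: points of `Σ_A` with lower Birkhoff average `α` and upper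
Birkhoff average `β`. -/
def LAb {K : ℕ} (M : Fin K → Fin K → Bool) (φ : ℕ → (ℕ → Fin K) → ℝ) (a b : ℝ) :
    Set (ℕ → Fin K) :=
  {x | x ∈ SigmaA M ∧ Filter.liminf (fun n => birk φ n x) Filter.atTop = a ∧
    Filter.limsup (fun n => birk φ n x) Filter.atTop = b}

/-- `L_A(α) = L_A(α,α)`. -/
def LA {K : ℕ} (M : Fin K → Fin K → Bool) (φ : ℕ → (ℕ → Fin K) → ℝ) (a : ℝ) :
    Set (ℕ → Fin K) := LAb M φ a a

/-- The set of divergence points of the (non-autonomous) Birkhoff averages. -/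
def DivSet {K : ℕ} (M : Fin K → Fin K → Bool) (φ : ℕ → (ℕ → Fin K) → ℝ) :
    Set (ℕ → Fin K) :=
  {x | x ∈ SigmaA M ∧ ¬ ∃ a : ℝ, Tendsto (fun n => birk φ n x) atTop (nhds a)}

/-! ### Comparing entropies of sets that agree off a sparse set of coordinates -/

/-- An indexed cover by words bounds `Hsr`, even if words are repeated. -/
theorem Hsr_le_tsum {α ι : Type*} {E : Set (ℕ → α)} {r : ℕ} (word : ι → Word α)
    (hr : ∀ i, r < (word i).len) (hE : ∀ z ∈ E, ∃ i, z ∈ (word i).cylSet) (s : ℝ) :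
    Hsr E s r ≤ ∑' i, ENNReal.ofReal (Real.exp (-s * ((word i).len : ℝ))) := by
  refine iInf_le_of_le (⋃ i, {word i}) (iInf_le_of_le ?_ (iInf_le_of_le ?_ ?_))
  · intro w hw
    obtain ⟨i, hi⟩ := mem_iUnion.1 hw
    rw [mem_singleton_iff.1 hi]
    exact hr i
  · intro z hz
    obtain ⟨i, hi⟩ := hE z hz
    exact mem_iUnion₂.2 ⟨word i, mem_iUnion.2 ⟨i, rfl⟩, hi⟩
  · let f : Word α → ℝ≥0∞ := fun w => ENNReal.ofReal (Real.exp (-s * (w.len : ℝ)))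
    exact (ENNReal.tsum_iUnion_le_tsum f _).trans_eq
      (tsum_congr fun i => tsum_singleton (word i) f)

open scoped Classical in
/-- If every point of `E` agrees with some point of `D` off the set `P` of coordinates, and `P`
has so few elements below each `n` that they carry at most `exp (δ n)` words, then covers of `D`
yield covers of `E` at the cost of increasing the exponent by `δ`. -/
theorem Hsr_le_of_agree_off {K : ℕ} {E D : Set (ℕ → Fin K)} {P : Set ℕ} {δ : ℝ}
    (hP : ∀ n : ℕ, (K : ℝ) ^ ((Finset.range n).filter (· ∈ P)).card ≤ Real.exp (δ * n))
    (hED : ∀ z ∈ E, ∃ w ∈ D, ∀ k ∉ P, w k = z k) (s : ℝ) (r : ℕ) :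
    Hsr E (s + δ) r ≤ Hsr D s r := by
  refine le_iInf fun S => le_iInf fun hS => le_iInf fun hcov => ?_
  let Q : Word (Fin K) → Finset ℕ := fun v => (Finset.range v.1).filter (· ∈ P)
  let modify : (Σ v : S, (Q v → Fin K)) → Word (Fin K) := fun p =>
    ⟨p.1.1.1, fun k => if h : (k : ℕ) ∈ Q p.1 then p.2 ⟨k, h⟩ else p.1.1.2 k⟩
  have hlen : ∀ p, (modify p).len = p.1.1.len := fun p => rfl
  refine (Hsr_le_tsum modify (fun p => hS p.1 p.1.2) (fun z hz => ?_) (s + δ)).trans ?_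
  · obtain ⟨w, hw, hwz⟩ := hED z hz
    obtain ⟨v, hv, hwv⟩ := mem_iUnion₂.1 (hcov hw)
    refine ⟨⟨⟨v, hv⟩, fun k => z k⟩, fun k => ?_⟩
    change z k = if h : (k : ℕ) ∈ Q v then z k else v.2 k
    split_ifs with h
    · rfl
    · have hk : (k : ℕ) ∉ P := fun hk => h (Finset.mem_filter.2 ⟨Finset.mem_range.2 k.2, hk⟩)
      rw [← hwz k hk]
      exact hwv k
  simp only [hlen]
  rw [ENNReal.tsum_sigma']
  refine ENNReal.tsum_le_tsum fun v => ?_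
  dsimp only
  rw [tsum_fintype, Finset.sum_const, nsmul_eq_mul, Finset.card_univ, Fintype.card_fun,
    Fintype.card_fin, Fintype.card_coe, ← ENNReal.ofReal_natCast,
    ← ENNReal.ofReal_mul (by positivity)]
  refine ENNReal.ofReal_le_ofReal ?_
  calc ((K ^ (Q v).card : ℕ) : ℝ) * Real.exp (-(s + δ) * (v.1.len : ℝ))
      ≤ Real.exp (δ * v.1.len) * Real.exp (-(s + δ) * (v.1.len : ℝ)) := by
        gcongr
        push_cast
        exact hP v.1.1
    _ = Real.exp (-s * (v.1.len : ℝ)) := by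
        rw [← Real.exp_add]
        ring_nf

theorem Hsr_mono_set {α : Type*} {E F : Set (ℕ → α)} (h : E ⊆ F) (s : ℝ) (r : ℕ) :
    Hsr E s r ≤ Hsr F s r :=
  le_iInf fun S => le_iInf fun hS => le_iInf fun hcov =>
    iInf_le_of_le S (iInf_le_of_le hS (iInf_le_of_le (h.trans hcov) le_rfl))

/-- The entropy of the full shift over `K` symbols is at most `log K`. -/
theorem Hentm_log_card_ne_top {K : ℕ} (hK : 0 < K) (E : Set (ℕ → Fin K)) :
    Hentm E (Real.log K) ≠ ⊤ := by
  refine ne_top_of_le_ne_top ENNReal.one_ne_top (iSup_le fun r => ?_)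
  let word : (Fin (r + 1) → Fin K) → Word (Fin K) := fun f => ⟨r + 1, f⟩
  refine (Hsr_le_tsum word (fun f => Nat.lt_succ_self r)
    (fun z _ => ⟨fun k => z k, fun k => rfl⟩) _).trans ?_
  have hlen : ∀ f, (word f).len = r + 1 := fun f => rfl
  have hK' : (0 : ℝ) < K := by exact_mod_cast hK
  simp only [hlen]
  rw [tsum_fintype, Finset.sum_const, nsmul_eq_mul, Finset.card_univ, Fintype.card_fun,
    Fintype.card_fin, Fintype.card_fin, ← ENNReal.ofReal_natCast,
    ← ENNReal.ofReal_mul (by positivity), ENNReal.ofReal_le_one]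
  rw [neg_mul, Real.exp_neg, mul_comm (Real.log K), Real.exp_nat_mul, Real.exp_log hK']
  push_cast
  exact (mul_inv_cancel₀ (by positivity)).le

open scoped Classical in
/-- A subset `D ⊆ E` has the same entropy as `E` if every point of `E` agrees with some point of
`D` off a set of coordinates of arbitrarily small density. -/
theorem htop_eq_of_agree_off {K : ℕ} {E D : Set (ℕ → Fin K)} (hDE : D ⊆ E)
    (hE : E.Nonempty)
    (h : ∀ m : ℕ, 0 < m → ∃ P : Set ℕ,
      (∀ n, m * ((Finset.range n).filter (· ∈ P)).card ≤ n) ∧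
      ∀ z ∈ E, ∃ w ∈ D, ∀ k ∉ P, w k = z k) :
    htop D = htop E := by
  obtain ⟨z, hz⟩ := hE
  have hK : 0 < K := (z 0).pos
  have hD : D.Nonempty := by
    obtain ⟨P, -, hP⟩ := h 1 one_pos
    obtain ⟨w, hw, -⟩ := hP z hz
    exact ⟨w, hw⟩
  rw [htop, htop, if_neg hD.ne_empty, if_neg (Set.Nonempty.ne_empty ⟨z, hz⟩)]
  have hlog : 0 ≤ Real.log K := Real.log_natCast_nonneg K
  have hbdd : ∀ F : Set (ℕ → Fin K), BddBelow {s : ℝ | 0 ≤ s ∧ Hentm F s ≠ ⊤} :=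
    fun F => ⟨0, fun s hs => hs.1⟩
  have hne : ∀ F : Set (ℕ → Fin K), {s : ℝ | 0 ≤ s ∧ Hentm F s ≠ ⊤}.Nonempty :=
    fun F => ⟨_, hlog, Hentm_log_card_ne_top hK F⟩
  congr 1
  apply le_antisymm
  · refine csInf_le_csInf (hbdd D) (hne E) fun s hs => ⟨hs.1, ne_top_of_le_ne_top hs.2 ?_⟩
    exact iSup_mono fun r => Hsr_mono_set hDE s r
  · refine le_csInf (hne D) fun s hs => le_of_forall_pos_le_add fun δ hδ => ?_
    refine csInf_le (hbdd E) ⟨by linarith [hs.1], ne_top_of_le_ne_top hs.2 ?_⟩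
    obtain ⟨m, hm⟩ := exists_nat_gt (Real.log K / δ)
    have hm0 : 0 < m := by
      have : (0 : ℝ) < m := (div_nonneg hlog hδ.le).trans_lt hm
      exact_mod_cast this
    obtain ⟨P, hP, hPE⟩ := h m hm0
    refine iSup_mono fun r => Hsr_le_of_agree_off (fun n => ?_) hPE s r
    set c := ((Finset.range n).filter (· ∈ P)).card with hc
    have hcn : (m : ℝ) * c ≤ n := by exact_mod_cast hP n
    have hlm : Real.log K ≤ δ * m := by
      rw [div_lt_iff₀ hδ] at hm
      linarith
    rw [← Real.exp_log (show (0 : ℝ) < K by exact_mod_cast hK), ← Real.exp_nat_mul]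
    refine Real.exp_le_exp.2 ?_
    calc (c : ℝ) * Real.log K ≤ c * (δ * m) := by gcongr
      _ = δ * (m * c) := by ring
      _ ≤ δ * n := by gcongr

/-! ### Sparse families of windows and gluing of admissible sequences -/

/-- The coordinates covered by the windows `[s j, s j + L j)`. -/
def windows (s L : ℕ → ℕ) : Set ℕ := {k | ∃ j, s j ≤ k ∧ k < s j + L j}

theorem window_end_le {s L : ℕ → ℕ} (h : ∀ j, s j + L j ≤ s (j + 1)) {i j : ℕ} (hij : i < j) :
    s i + L i ≤ s j :=
  (h i).trans (monotone_nat_of_le_succ (fun j => (Nat.le_add_right _ _).trans (h j)) hij)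

open scoped Classical in
/-- If the total length of the first windows is at most `s j / m`, the windows have density at
most `1 / m`. -/
theorem mul_card_windows_le {s L : ℕ → ℕ} {m : ℕ} (hL : ∀ j, 0 < L j)
    (h : ∀ j, s j + L j ≤ s (j + 1))
    (hm : ∀ j, m * ∑ i ∈ Finset.range (j + 1), L i ≤ s j) (n : ℕ) :
    m * ((Finset.range n).filter (· ∈ windows s L)).card ≤ n := by
  have hs : StrictMono s := strictMono_nat_of_lt_succ fun j => by
    have := h j
    have := hL j
    omega
  have hex : ∃ j, n ≤ s j := ⟨n, hs.le_apply⟩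
  rcases hJ : Nat.find hex with _ | J
  · have h0 : n ≤ s 0 := hJ ▸ Nat.find_spec hex
    rw [Finset.filter_eq_empty_iff.2]
    · simp
    · rintro k hk ⟨j, hj, -⟩
      have := hs.monotone (Nat.zero_le j)
      have := Finset.mem_range.1 hk
      omega
  · have h1 : n ≤ s (J + 1) := hJ ▸ Nat.find_spec hex
    have h2 : s J < n := not_le.1 (Nat.find_min hex (by omega))
    have hsub : (Finset.range n).filter (· ∈ windows s L) ⊆
        (Finset.range (J + 1)).biUnion fun i => Finset.Ico (s i) (s i + L i) := by
      intro k hk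
      obtain ⟨hkn, j, hj⟩ := Finset.mem_filter.1 hk
      refine Finset.mem_biUnion.2 ⟨j, Finset.mem_range.2 ?_, Finset.mem_Ico.2 hj⟩
      by_contra! hjJ
      have := hs.monotone hjJ
      have := Finset.mem_range.1 hkn
      omega
    calc m * ((Finset.range n).filter (· ∈ windows s L)).card
        ≤ m * ∑ i ∈ Finset.range (J + 1), L i := by
          gcongr
          refine (Finset.card_le_card hsub).trans (Finset.card_biUnion_le.trans ?_)
          simp
      _ ≤ s J := hm J
      _ ≤ n := h2.le

/-- Between any two symbols one can insert the beginning of an admissible sequence, leaving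
room for connecting paths of length `r` at both ends. -/
theorem exists_bridge {K : ℕ} {M : Fin K → Fin K → Bool} {r : ℕ}
    (hr : ∀ i j : Fin K, ∃ p : ℕ → Fin K, p 0 = i ∧ p r = j ∧
      ∀ k < r, M (p k) (p (k + 1)) = true)
    {L : ℕ} (hL : 2 * r ≤ L) (a c : Fin K) {t : ℕ → Fin K} (ht : t ∈ SigmaA M) :
    ∃ b : ℕ → Fin K, b 0 = a ∧ b L = c ∧ (∀ k < L, M (b k) (b (k + 1)) = true) ∧
      ∀ i, 2 * r + i ≤ L → b (r + i) = t i := by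
  obtain ⟨p, hp0, hpr, hp⟩ := hr a (t 0)
  obtain ⟨q, hq0, hqr, hq⟩ := hr (t (L - 2 * r)) c
  let b : ℕ → Fin K := fun k =>
    if k < r then p k else if k ≤ L - r then t (k - r) else q (k - (L - r))
  have hb1 : ∀ k ≤ r, b k = p k := by
    intro k hk
    rcases hk.lt_or_eq with h | rfl
    · exact if_pos h
    · simp only [b, lt_irrefl, if_false, Nat.sub_self, hpr]
      exact if_pos (by omega)
  have hb2 : ∀ i, 2 * r + i ≤ L → b (r + i) = t i := by
    intro i hi
    simp only [b]
    rw [if_neg (by omega), if_pos (by omega), Nat.add_sub_cancel_left]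
  have hb3 : ∀ k, b (L - r + k) = q k := by
    intro k
    rcases k.eq_zero_or_pos with rfl | h
    · rw [hq0, ← hb2 _ (by omega)]
      congr 1
      omega
    · simp only [b]
      rw [if_neg (by omega), if_neg (by omega), Nat.add_sub_cancel_left]
  refine ⟨b, by rw [hb1 0 (Nat.zero_le r), hp0], ?_, fun k hk => ?_, hb2⟩
  · rw [← hqr, ← hb3]
    congr 1
    omega
  · rcases lt_or_ge k r with h | h
    · rw [hb1 k h.le, hb1 (k + 1) h]
      exact hp k h
    · rcases lt_or_ge k (L - r) with h' | h'
      · obtain ⟨i, rfl⟩ := Nat.exists_eq_add_of_le h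
        rw [hb2 i (by omega), add_assoc, hb2 (i + 1) (by omega)]
        exact ht i
      · obtain ⟨i, rfl⟩ := Nat.exists_eq_add_of_le h'
        rw [hb3 i, add_assoc, hb3 (i + 1)]
        exact hq i (by omega)

open scoped Classical in
/-- Any admissible sequence can be modified inside disjoint windows so as to follow prescribed
admissible sequences there. -/
theorem exists_glued {K : ℕ} {M : Fin K → Fin K → Bool} {r : ℕ}
    (hr : ∀ i j : Fin K, ∃ p : ℕ → Fin K, p 0 = i ∧ p r = j ∧
      ∀ k < r, M (p k) (p (k + 1)) = true)
    {s L : ℕ → ℕ} (hL : ∀ j, 2 * r ≤ L j) (h : ∀ j, s j + L j ≤ s (j + 1))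
    {z : ℕ → Fin K} (hz : z ∈ SigmaA M) {t : ℕ → ℕ → Fin K} (ht : ∀ j, t j ∈ SigmaA M) :
    ∃ w ∈ SigmaA M, (∀ k ∉ windows s L, w k = z k) ∧
      ∀ j i, 2 * r + i < L j → w (s j + r + i) = t j i := by
  choose b hb0 hbL hbM hbt using fun j =>
    exists_bridge hr (hL j) (z (s j)) (z (s j + L j)) (ht j)
  let w : ℕ → Fin K := fun k =>
    if h : ∃ j, s j ≤ k ∧ k < s j + L j then b h.choose (k - s h.choose) else z k
  have hwin : ∀ j k, s j ≤ k → k < s j + L j → w k = b j (k - s j) := by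
    intro j k h1 h2
    have hex : ∃ j, s j ≤ k ∧ k < s j + L j := ⟨j, h1, h2⟩
    have hj : hex.choose = j := by
      obtain ⟨h3, h4⟩ := hex.choose_spec
      rcases lt_trichotomy hex.choose j with hlt | heq | hlt
      · have := window_end_le h hlt
        omega
      · exact heq
      · have := window_end_le h hlt
        omega
    simp only [w, dif_pos hex, hj]
  have hout : ∀ k ∉ windows s L, w k = z k := fun k hk => dif_neg hk
  have hstart : ∀ j k, k = s j → w k = z k := by
    rintro j k rfl
    by_cases hk : s j ∈ windows s L
    · by_cases hLj : 0 < L j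
      · rw [hwin j _ le_rfl (by omega), Nat.sub_self, hb0]
      · obtain ⟨i, h1, h2⟩ := hk
        rcases lt_trichotomy i j with hlt | rfl | hlt
        · have := window_end_le h hlt
          omega
        · omega
        · have := window_end_le h hlt
          have heq : s j = s i := by omega
          rw [heq, hwin i _ le_rfl (by omega), Nat.sub_self, hb0]
    · exact hout _ hk
  have hend : ∀ j k, k = s j + L j → w k = z k := by
    intro j k hk
    by_cases hkw : k ∈ windows s L
    · obtain ⟨i, h1, h2⟩ := hkw
      rcases lt_trichotomy i j with hlt | rfl | hlt
      · have := window_end_le h hlt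
        omega
      · omega
      · have := window_end_le h hlt
        exact hstart i k (by omega)
    · exact hout _ hkw
  refine ⟨w, fun k => ?_, hout, fun j i hi => ?_⟩
  · by_cases hk : k ∈ windows s L
    · obtain ⟨j, h1, h2⟩ := hk
      obtain ⟨i, rfl⟩ := Nat.exists_eq_add_of_le h1
      have hnext : w (s j + i + 1) = b j (i + 1) := by
        rcases (show i + 1 ≤ L j by omega).lt_or_eq with hlt | heq
        · rw [hwin j _ (by omega) (by omega)]
          congr 1
          omega
        · rw [hend j _ (by omega), heq, hbL, add_assoc, heq]
      rw [hwin j _ h1 h2, hnext, Nat.add_sub_cancel_left]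
      exact hbM j i (by omega)
    · have hnext : w (k + 1) = z (k + 1) := by
        by_cases hk1 : k + 1 ∈ windows s L
        · obtain ⟨j, h1, h2⟩ := hk1
          refine hstart j _ ?_
          by_contra hne
          exact hk ⟨j, by omega, by omega⟩
        · exact hout _ hk1
      rw [hout k hk, hnext]
      exact hz k
  · rw [hwin j _ (by omega) (by omega), ← hbt j i (by omega)]
    congr 1
    omega

/-! ### Birkhoff sums of sequences that agree on long windows -/

theorem shift_iterate_apply {α : Type*} (k : ℕ) (x : ℕ → α) (i : ℕ) :
    shift^[k] x i = x (k + i) := by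
  induction k generalizing x with
  | zero => simp
  | succ k ih =>
    rw [Function.iterate_succ_apply, ih, shift]
    congr 1
    omega

theorem shift_iterate_mem_SigmaA {K : ℕ} {M : Fin K → Fin K → Bool} {x : ℕ → Fin K}
    (hx : x ∈ SigmaA M) (k : ℕ) : shift^[k] x ∈ SigmaA M := by
  intro i
  rw [shift_iterate_apply, shift_iterate_apply]
  exact hx (k + i)

/-- The oscillation of `φ k` over `Σ_A` is `o(k)`. -/
def SublinearOsc {K : ℕ} (M : Fin K → Fin K → Bool) (φ : ℕ → (ℕ → Fin K) → ℝ) : Prop :=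
  ∀ c > (0 : ℝ), ∃ k₀ : ℕ, ∀ k ≥ k₀, ∀ u ∈ SigmaA M, ∀ v ∈ SigmaA M, |φ k u - φ k v| ≤ c * k

theorem Finset.sum_Ico_tail_le {p q N : ℕ} {g : ℕ → ℝ} {η B : ℝ} (hη : 0 ≤ η) (hB : 0 ≤ B)
    (h1 : ∀ k ∈ Finset.Ico p q, k + N ≤ q → g k ≤ η)
    (h2 : ∀ k ∈ Finset.Ico p q, g k ≤ B) :
    ∑ k ∈ Finset.Ico p q, g k ≤ η * q + N * B := by
  calc ∑ k ∈ Finset.Ico p q, g k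
      ≤ ∑ k ∈ Finset.Ico p q, (η + if q < k + N then B else 0) := by
        refine Finset.sum_le_sum fun k hk => ?_
        split_ifs with h
        · linarith [h2 k hk]
        · linarith [h1 k hk (not_lt.1 h)]
    _ = (Finset.Ico p q).card * η + ((Finset.Ico p q).filter (fun k => q < k + N)).card * B := by
        rw [Finset.sum_add_distrib, Finset.sum_const, ← Finset.sum_filter, Finset.sum_const,
          nsmul_eq_mul, nsmul_eq_mul]
    _ ≤ q * η + N * B := by
        have hc1 : (Finset.Ico p q).card ≤ q := by simp
        have hc2 : ((Finset.Ico p q).filter (fun k => q < k + N)).card ≤ N := by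
          have hsub : (Finset.Ico p q).filter (fun k => q < k + N) ⊆ Finset.Ico (q - N) q := by
            intro k hk
            simp only [Finset.mem_filter, Finset.mem_Ico] at hk ⊢
            omega
          refine (Finset.card_le_card hsub).trans ?_
          rw [Nat.card_Ico]
          omega
        have hc1' : ((Finset.Ico p q).card : ℝ) ≤ q := by exact_mod_cast hc1
        have hc2' : (((Finset.Ico p q).filter (fun k => q < k + N)).card : ℝ) ≤ N := by
          exact_mod_cast hc2
        gcongr
    _ = η * q + N * B := by ring

theorem eventually_abs_sum_sub_le {f : ℕ → ℝ} {a : ℝ}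
    (h : Tendsto (fun n : ℕ => (∑ k ∈ Finset.range n, f k) / n) atTop (nhds a))
    {η : ℝ} (hη : 0 < η) :
    ∀ᶠ n : ℕ in atTop, |∑ k ∈ Finset.range n, f k - a * n| ≤ η * n := by
  filter_upwards [Metric.tendsto_nhds.1 h η hη, eventually_gt_atTop 0] with n hn hn0
  have hn' : (0 : ℝ) < n := by exact_mod_cast hn0
  rw [Real.dist_eq] at hn
  have heq : ∑ k ∈ Finset.range n, f k - a * n = ((∑ k ∈ Finset.range n, f k) / n - a) * n := by
    field_simp
  rw [heq, abs_mul, abs_of_pos hn']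
  gcongr

/-- Two sequences with convergent averages that agree on windows of length proportional to their
position have the same average. -/
theorem birk_limit_eq_of_agree {K : ℕ} {M : Fin K → Fin K → Bool}
    {φ : ℕ → (ℕ → Fin K) → ℝ} (hUDV : UDV M φ) (hosc : SublinearOsc M φ)
    {u v : ℕ → Fin K} (hu : u ∈ SigmaA M) (hv : v ∈ SigmaA M) {a b : ℝ}
    (hua : Tendsto (fun n => birk φ n u) atTop (nhds a))
    (hvb : Tendsto (fun n => birk φ n v) atTop (nhds b))
    {C : ℕ} (p q : ℕ → ℕ) (hp : Tendsto p atTop atTop) (hpq : ∀ j, p j < q j)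
    (hC : ∀ j, q j ≤ C * (q j - p j))
    (huv : ∀ j k, p j ≤ k → k < q j → u k = v k) : a = b := by
  set g : ℕ → ℝ := fun k => φ k (shift^[k] u) - φ k (shift^[k] v) with hg
  have hlim : Tendsto (fun n : ℕ => (∑ k ∈ Finset.range n, g k) / n) atTop (nhds (a - b)) := by
    refine (hua.sub hvb).congr fun n => ?_
    simp only [birk, hg, Finset.sum_sub_distrib, sub_div]
  have key : ∀ η > (0 : ℝ), |a - b| ≤ 4 * C * η := by
    intro η hη
    obtain ⟨N, hN⟩ := hUDV η hη
    obtain ⟨k₀, hk₀⟩ := hosc (η / (N + 1)) (by positivity)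
    have hq : Tendsto q atTop atTop := tendsto_atTop_mono (fun j => (hpq j).le) hp
    have hev := eventually_abs_sum_sub_le hlim hη
    obtain ⟨j, hjp, hjq, hjk⟩ :=
      ((hp.eventually hev).and ((hq.eventually hev).and (hp.eventually_ge_atTop k₀))).exists
    have hlt := hpq j
    have hCj : (q j : ℝ) ≤ C * ((q j : ℝ) - p j) := by
      have := hC j
      rw [← Nat.cast_sub hlt.le]
      exact_mod_cast this
    have hagree := huv j
    generalize p j = p at *
    generalize q j = q at *
    have hlt' : (p : ℝ) < q := by exact_mod_cast hlt
    have hsum : |∑ k ∈ Finset.range q, g k - ∑ k ∈ Finset.range p, g k| ≤ 2 * η * q := by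
      rw [← Finset.sum_Ico_eq_sub _ hlt.le]
      refine (Finset.abs_sum_le_sum_abs _ _).trans ((Finset.sum_Ico_tail_le (N := N)
        (B := η / (N + 1) * q) hη.le (by positivity) ?_ ?_).trans ?_)
      · intro k hk hkN
        refine (hN N le_rfl k _ (shift_iterate_mem_SigmaA hu k) _
          (shift_iterate_mem_SigmaA hv k) fun i hi => ?_).le
        rw [shift_iterate_apply, shift_iterate_apply]
        have := (Finset.mem_Ico.1 hk).1
        exact hagree _ (by omega) (by omega)
      · intro k hk
        obtain ⟨h1, h2⟩ := Finset.mem_Ico.1 hk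
        refine (hk₀ k (hjk.trans h1) _ (shift_iterate_mem_SigmaA hu k) _
          (shift_iterate_mem_SigmaA hv k)).trans ?_
        gcongr
      · have : (N : ℝ) * (η / (N + 1) * q) ≤ η * q := by
          have hN1 : (N : ℝ) / (N + 1) ≤ 1 := by
            rw [div_le_one (by positivity)]
            linarith
          calc (N : ℝ) * (η / (N + 1) * q) = N / (N + 1) * (η * q) := by ring
            _ ≤ 1 * (η * q) := by gcongr
            _ = η * q := one_mul _
        linarith
    have hpη : η * p ≤ η * q := by gcongr
    have hbound : |a - b| * (q - p) ≤ 4 * η * q := by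
      rw [← abs_of_pos (sub_pos.2 hlt'), ← abs_mul]
      have e1 := abs_le.1 hsum
      have e2 := abs_le.1 hjp
      have e3 := abs_le.1 hjq
      refine abs_le.2 ⟨?_, ?_⟩ <;> linarith [e1.1, e1.2, e2.1, e2.2, e3.1, e3.2]
    refine le_of_mul_le_mul_right ?_ (sub_pos.2 hlt')
    calc |a - b| * (q - p) ≤ 4 * η * q := hbound
      _ ≤ 4 * η * (C * (q - p)) := by gcongr
      _ = 4 * C * η * (q - p) := by ring
  have hle : |a - b| ≤ 0 := by
    refine le_of_forall_pos_le_add fun ε hε => ?_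
    refine (key (ε / (4 * C + 1)) (by positivity)).trans ?_
    rw [zero_add, ← mul_div_assoc, div_le_iff₀ (by positivity)]
    linarith
  exact sub_eq_zero.1 (abs_eq_zero.1 (le_antisymm hle (abs_nonneg _)))

/-- If the terms of a sequence exceed a fixed multiple of their index infinitely often, its
averages diverge. -/
theorem not_tendsto_avg_of_frequently_large {f : ℕ → ℝ} {c : ℝ} (hc : 0 < c)
    (h : ∃ᶠ k : ℕ in atTop, c * k ≤ |f k|) (a : ℝ) :
    ¬ Tendsto (fun n : ℕ => (∑ k ∈ Finset.range n, f k) / n) atTop (nhds a) := by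
  intro hlim
  have hev := eventually_abs_sum_sub_le hlim (show 0 < c / 4 by positivity)
  obtain ⟨n, hn⟩ := exists_nat_gt ((|a| + c) / (c / 2))
  rw [div_lt_iff₀ (by positivity)] at hn
  obtain ⟨k, hk, h1, h2, hkn⟩ := (h.and_eventually
    (hev.and (((tendsto_add_atTop_nat 1).eventually hev).and (eventually_ge_atTop n)))).exists
  rw [Finset.sum_range_succ] at h2
  push_cast at h2
  have hkn' : (n : ℝ) ≤ k := by exact_mod_cast hkn
  have hbig : |f k| ≤ |a| + c / 4 * (2 * k + 1) := by
    have e1 := abs_le.1 h1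
    have e2 := abs_le.1 h2
    refine abs_le.2 ⟨?_, ?_⟩ <;>
      linarith [e1.1, e1.2, e2.1, e2.2, le_abs_self a, neg_abs_le a]
  nlinarith

/-! ### Modifying sequences sparsely to make their averages diverge -/

open scoped Classical in
theorem exists_sparse_agree_DivSet_of_sublinearOsc {K : ℕ} {M : Fin K → Fin K → Bool}
    (hA : ApIrr M) {φ : ℕ → (ℕ → Fin K) → ℝ} (hUDV : UDV M φ) (hosc : SublinearOsc M φ)
    {x y : ℕ → Fin K} (hx : x ∈ SigmaA M) (hy : y ∈ SigmaA M) {a b : ℝ} (hab : a ≠ b)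
    (hxa : Tendsto (fun n => birk φ n x) atTop (nhds a))
    (hyb : Tendsto (fun n => birk φ n y) atTop (nhds b)) {m : ℕ} (hm : 0 < m) :
    ∃ P : Set ℕ, (∀ n, m * ((Finset.range n).filter (· ∈ P)).card ≤ n) ∧
      ∀ z ∈ SigmaA M, ∃ w ∈ DivSet M φ, ∀ k ∉ P, w k = z k := by
  obtain ⟨r, hr0, hr⟩ := hA
  let L : ℕ → ℕ := fun j => 2 ^ (j + 4 * r)
  let s : ℕ → ℕ := fun j => 2 * m * L j
  have hLr : ∀ j, 4 * r + j < L j := fun j => by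
    have := Nat.lt_two_pow_self (n := j + 4 * r)
    simp only [L]
    omega
  have hLs : ∀ j, L (j + 1) = 2 * L j := fun j => by simp only [L]; ring
  have hmL : ∀ j, L j ≤ m * L j := fun j => Nat.le_mul_of_pos_left _ hm
  have hs : ∀ j, s j = 2 * (m * L j) := fun j => by simp only [s]; ring
  have hs1 : ∀ j, s (j + 1) = 4 * (m * L j) := fun j => by simp only [s, hLs]; ring
  have hdisj : ∀ j, s j + L j ≤ s (j + 1) := fun j => by
    have := hmL j
    have := hs j
    have := hs1 j
    omega
  refine ⟨windows s L, mul_card_windows_le (fun j => by have := hLr j; omega) hdisj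
    fun j => ?_, fun z hz => ?_⟩
  · have hsum : ∑ i ∈ Finset.range (j + 1), L i ≤ 2 * L j := by
      induction j with
      | zero => simp; omega
      | succ j ih =>
        rw [Finset.sum_range_succ]
        have := hLs j
        omega
    calc m * ∑ i ∈ Finset.range (j + 1), L i ≤ m * (2 * L j) := by gcongr
      _ = s j := by simp only [s]; ring
  · by_cases hzD : z ∈ DivSet M φ
    · exact ⟨z, hzD, fun k _ => rfl⟩
    obtain ⟨α, hα⟩ : ∃ α : ℝ, Tendsto (fun n => birk φ n z) atTop (nhds α) := by
      by_contra hne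
      exact hzD ⟨hz, hne⟩
    obtain ⟨t, ht, β, hβ, hβα⟩ : ∃ t ∈ SigmaA M, ∃ β : ℝ,
        Tendsto (fun n => birk φ n t) atTop (nhds β) ∧ β ≠ α := by
      by_cases haα : a = α
      · exact ⟨y, hy, b, hyb, fun hbα => hab (haα.trans hbα.symm)⟩
      · exact ⟨x, hx, a, hxa, haα⟩
    obtain ⟨w, hw, hwz, hwt⟩ := exists_glued hr (s := s) (L := L)
      (fun j => by have := hLr j; omega) hdisj hz
      (t := fun j => shift^[s j + r] t) (fun j => shift_iterate_mem_SigmaA ht _)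
    refine ⟨w, ⟨hw, ?_⟩, hwz⟩
    rintro ⟨γ, hγ⟩
    have hγβ : γ = β := by
      refine birk_limit_eq_of_agree hUDV hosc hw ht hγ hβ (C := 4 * m + 2)
        (fun j => s j + r) (fun j => s j + L j - r) ?_ ?_ ?_ ?_
      · refine tendsto_atTop_mono (fun j => ?_) tendsto_id
        have := hLr j
        have := hmL j
        have := hs j
        simp only [id]
        omega
      · intro j
        have := hLr j
        omega
      · intro j
        have h1 := hLr j
        obtain ⟨d, hd⟩ : ∃ d, L j = d + 2 * r := ⟨L j - 2 * r, by omega⟩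
        have h2 : s j + L j - r - (s j + r) = d := by omega
        rw [h2, hs]
        have h3 : m * L j ≤ m * (2 * d) := by
          gcongr
          omega
        have h4 : (4 * m + 2) * d = 2 * (m * (2 * d)) + 2 * d := by ring
        omega
      · intro j k h1 h2
        obtain ⟨i, rfl⟩ := Nat.exists_eq_add_of_le h1
        rw [hwt j i (by omega), shift_iterate_apply]
    have hγα : γ = α := by
      refine birk_limit_eq_of_agree hUDV hosc hw hz hγ hα (C := 4 * m)
        (fun j => s j + L j) (fun j => s (j + 1)) ?_ ?_ ?_ ?_
      · refine tendsto_atTop_mono (fun j => ?_) tendsto_id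
        have := hLr j
        simp only [id]
        omega
      · intro j
        have := hLr j
        have := hmL j
        have := hs j
        have := hs1 j
        omega
      · intro j
        have h1 := hmL j
        have h2 := hs j
        have h3 := hs1 j
        have h4 : L j ≤ s (j + 1) - (s j + L j) := by omega
        calc s (j + 1) = 4 * m * L j := by rw [h3]; ring
          _ ≤ 4 * m * (s (j + 1) - (s j + L j)) := by gcongr
      · intro j k h1 h2
        refine hwz k ?_
        rintro ⟨i, h3, h4⟩
        rcases lt_trichotomy i j with hlt | rfl | hlt
        · have := window_end_le hdisj hlt
          omega
        · omega
        · have hmono : Monotone s :=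
            monotone_nat_of_le_succ fun j => (Nat.le_add_right _ _).trans (hdisj j)
          have := hmono (Nat.succ_le_of_lt hlt)
          rw [Nat.succ_eq_add_one] at this
          omega
    exact hβα (hγβ.symm.trans hγα)

open scoped Classical in
theorem exists_sparse_agree_DivSet_of_not_sublinearOsc {K : ℕ} {M : Fin K → Fin K → Bool}
    (hA : ApIrr M) {φ : ℕ → (ℕ → Fin K) → ℝ} (hUDV : UDV M φ) (hosc : ¬ SublinearOsc M φ)
    (m : ℕ) :
    ∃ P : Set ℕ, (∀ n, m * ((Finset.range n).filter (· ∈ P)).card ≤ n) ∧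
      ∀ z ∈ SigmaA M, ∃ w ∈ DivSet M φ, ∀ k ∉ P, w k = z k := by
  obtain ⟨r, hr0, hr⟩ := hA
  obtain ⟨N, hN⟩ := hUDV 1 one_pos
  simp only [SublinearOsc] at hosc
  push Not at hosc
  obtain ⟨c, hc, hbad⟩ := hosc
  have hfreq : ∃ᶠ k : ℕ in atTop, ∃ u ∈ SigmaA M, c / 2 * k < |φ k u| := by
    refine frequently_atTop.2 fun k₀ => ?_
    obtain ⟨k, hk, u, hu, v, hv, huv⟩ := hbad k₀
    refine ⟨k, hk, ?_⟩
    by_contra! hsmall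
    have h1 := hsmall u hu
    have h2 := hsmall v hv
    have h3 := abs_sub (φ k u) (φ k v)
    linarith
  obtain ⟨κ, hκ, hlarge⟩ := extraction_of_frequently_atTop hfreq
  choose u hu huκ using hlarge
  let ℓ : ℕ := N + 2 * r + 1
  let Q : ℕ := m * ℓ + ℓ + r
  let idx : ℕ → ℕ := fun j => Q * (j + 1)
  have hidx : ∀ j, idx (j + 1) = Q + idx j := fun j => by simp only [idx]; ring
  have hstep : ∀ j, Q + κ (idx j) ≤ κ (idx (j + 1)) := fun j => by
    rw [hidx]
    exact hκ.add_le_nat Q (idx j)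
  have hge : ∀ j, m * ℓ * (j + 1) + r ≤ κ (idx j) := fun j => by
    refine le_trans ?_ hκ.le_apply
    simp only [idx, Q]
    nlinarith [Nat.zero_le (r * j), Nat.zero_le (ℓ * (j + 1))]
  let s : ℕ → ℕ := fun j => κ (idx j) - r
  have hsκ : ∀ j, s j + r = κ (idx j) := fun j => by
    have := hge j
    simp only [s]
    omega
  have hdisj : ∀ j, s j + ℓ ≤ s (j + 1) := fun j => by
    have h1 := hsκ j
    have h2 := hsκ (j + 1)
    have h3 := hstep j
    have h4 : ℓ ≤ Q := by simp only [Q]; omega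
    omega
  refine ⟨windows s fun _ => ℓ, mul_card_windows_le (fun _ => Nat.succ_pos _) hdisj fun j => ?_,
    fun z hz => ?_⟩
  · have h1 := hge j
    have h2 := hsκ j
    have h3 : m * ∑ i ∈ Finset.range (j + 1), ℓ = m * ℓ * (j + 1) := by
      rw [Finset.sum_const, Finset.card_range, smul_eq_mul]
      ring
    omega
  · obtain ⟨w, hw, hwz, hwu⟩ := exists_glued hr (s := s) (L := fun _ => ℓ)
      (fun j => by simp only [ℓ]; omega) hdisj hz (t := fun j => u (idx j)) (fun j => hu _)
    refine ⟨w, ⟨hw, ?_⟩, hwz⟩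
    rintro ⟨γ, hγ⟩
    refine not_tendsto_avg_of_frequently_large (c := c / 4) (by positivity) ?_ γ hγ
    obtain ⟨n, hn⟩ := exists_nat_gt (1 / (c / 4))
    rw [div_lt_iff₀ (by positivity)] at hn
    have hidx_ge : ∀ j, j ≤ κ (idx j) := fun j => by
      refine le_trans ?_ hκ.le_apply
      calc j ≤ j + 1 := Nat.le_succ j
        _ ≤ Q * (j + 1) := Nat.le_mul_of_pos_left _ (by simp only [Q, ℓ]; omega)
    refine frequently_atTop.2 fun k₀ => ⟨κ (idx (max k₀ n)), ?_, ?_⟩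
    · exact (le_max_left _ _).trans (hidx_ge _)
    · have hle : n ≤ κ (idx (max k₀ n)) := (le_max_right _ _).trans (hidx_ge _)
      generalize max k₀ n = j at *
      have hle' : (n : ℝ) ≤ κ (idx j) := by exact_mod_cast hle
      have hclose := hN N le_rfl (κ (idx j)) _ (shift_iterate_mem_SigmaA hw (κ (idx j)))
        (u (idx j)) (hu _) fun i hi => by
          rw [shift_iterate_apply, ← hsκ]
          exact hwu j i (by simp only [ℓ]; omega)
      have h1 := huκ (idx j)
      have h2 := abs_sub_abs_le_abs_sub (φ (κ (idx j)) (u (idx j)))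
        (φ (κ (idx j)) (shift^[κ (idx j)] w))
      rw [abs_sub_comm] at h2
      nlinarith

theorem irregular_set_full_entropy
    {K : ℕ} (M : Fin K → Fin K → Bool) (hA : ApIrr M)
    (φ : ℕ → (ℕ → Fin K) → ℝ)
    (hcont : ∀ i : ℕ, ContinuousOn (φ i) (SigmaA M))
    (hUDV : UDV M φ)
    (htwo : ∃ x ∈ SigmaA M, ∃ y ∈ SigmaA M, ∃ a b : ℝ, a ≠ b ∧
      Tendsto (fun n => birk φ n x) atTop (nhds a) ∧
      Tendsto (fun n => birk φ n y) atTop (nhds b)) :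
    htop (DivSet M φ) = htop (SigmaA M) := by
  obtain ⟨x, hx, y, hy, a, b, hab, hxa, hyb⟩ := htwo
  refine htop_eq_of_agree_off (fun z hz => hz.1) ⟨x, hx⟩ fun m hm => ?_
  by_cases hosc : SublinearOsc M φ
  · exact exists_sparse_agree_DivSet_of_sublinearOsc hA hUDV hosc hx hy hab hxa hyb hm
  · exact exists_sparse_agree_DivSet_of_not_sublinearOsc hA hUDV hosc m
end

section
/- Let 𝐰 ∈ {1,…,N}^ℕ be a q-frequency regular sequence with frequencies q = (q_1,…,q_N), let (f_{j,i}) (1 ≤ j ≤ N, 1 ≤ i ≤ K) be real numbers, and suppose that the function i ↦ g_i = Σ_{j=1}^N q_j f_{j,i} is not constant. Let D_𝐰 = {𝐢 ∈ Σ : lim_{n→∞} (1/n) Σ_{k=0}^{n−1} f_{w_k, i_k} does not exist}. Then h_top(D_𝐰) = log K. -/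
open Filter Set
open scoped ENNReal

/-- `q` is a probability vector. -/
def ProbVec {N : ℕ} (q : Fin N → ℝ) : Prop :=
  (∀ j, 0 ≤ q j) ∧ ∑ j, q j = 1

/-- `𝐰` is `q`-frequency regular: every symbol `j` occurs with asymptotic
frequency `q j`. -/
def FreqReg {N : ℕ} (w : ℕ → Fin N) (q : Fin N → ℝ) : Prop :=
  ∀ j : Fin N, Tendsto
    (fun n : ℕ => (((Finset.range (n + 1)).filter (fun k => w k = j)).card : ℝ) / n)
    atTop (nhds (q j))

/-- The level set `E_𝐰(α)` of the weighted Birkhoff average determined by the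
values `f j i` (potential depending on the first coordinates). -/
def EwSet {N K : ℕ} (f : Fin N → Fin K → ℝ) (w : ℕ → Fin N) (α : ℝ) :
    Set (ℕ → Fin K) :=
  {x | Tendsto (fun n : ℕ => (∑ k ∈ Finset.range n, f (w k) (x k)) / n) atTop (nhds α)}

open Topology MeasureTheory

/-- The Cesàro averages of `a` restricted to the dyadic blocks of even index diverge as soon as
those of `a` have a nonzero limit. -/
theorem not_tendsto_average_dyadic {a : ℕ → ℝ} {δ : ℝ} (hδ : δ ≠ 0)
    (ha : Tendsto (fun n : ℕ => (∑ k ∈ Finset.range n, a k) / n) atTop (𝓝 δ)) :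
    ¬ ∃ L : ℝ, Tendsto
      (fun n : ℕ => (∑ k ∈ Finset.range n, if Even (Nat.log 2 k) then a k else 0) / n)
      atTop (𝓝 L) := by
  rintro ⟨L, hL⟩
  have key : ∀ (b : ℕ → ℝ) (l : ℝ) (v : ℕ → ℕ), Tendsto v atTop atTop →
      Tendsto (fun n : ℕ => (∑ k ∈ Finset.range n, b k) / n) atTop (𝓝 l) →
      Tendsto (fun m => (∑ k ∈ Finset.Ico (2 ^ v m) (2 ^ (v m + 1)), b k) / (2 : ℝ) ^ v m)
        atTop (𝓝 l) := by
    intro b l v hv hb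
    have hp : Tendsto (fun m => 2 ^ v m) atTop atTop :=
      (tendsto_pow_atTop_atTop_of_one_lt one_lt_two).comp hv
    have hp' : Tendsto (fun m => 2 ^ (v m + 1)) atTop atTop :=
      (tendsto_pow_atTop_atTop_of_one_lt one_lt_two).comp (tendsto_add_atTop_nat 1 |>.comp hv)
    have h := ((hb.comp hp').const_mul 2).sub (hb.comp hp)
    rw [show 2 * l - l = l by ring] at h
    refine h.congr fun m => ?_
    rw [Finset.sum_Ico_eq_sub _ (Nat.pow_le_pow_right two_pos (Nat.le_succ _))]
    simp only [Function.comp_apply, Nat.cast_pow, Nat.cast_ofNat]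
    rw [pow_succ (2 : ℝ)]
    field_simp
  have hlog : ∀ m k, k ∈ Finset.Ico (2 ^ m) (2 ^ (m + 1)) → Nat.log 2 k = m := by
    intro m k hk
    rw [Finset.mem_Ico] at hk
    exact Nat.log_eq_of_pow_le_of_lt_pow hk.1 hk.2
  have hodd := key _ L (fun m => 2 * m + 1)
    (tendsto_atTop_mono (fun m => by omega : ∀ m, m ≤ 2 * m + 1) tendsto_id) hL
  have hev : Tendsto (fun m : ℕ => 2 * m) atTop atTop :=
    tendsto_atTop_mono (fun m => by omega : ∀ m, m ≤ 2 * m) tendsto_id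
  have heven := key _ L _ hev hL
  have hL0 : L = 0 := by
    refine tendsto_nhds_unique hodd (tendsto_const_nhds.congr fun m => ?_)
    rw [Finset.sum_eq_zero, zero_div]
    intro k hk
    rw [hlog _ k hk, if_neg (by simp)]
  refine hδ ((tendsto_nhds_unique (key a δ _ hev ha) (heven.congr fun m => ?_)).trans hL0)
  congr 1
  refine Finset.sum_congr rfl fun k hk => ?_
  rw [hlog _ k hk, if_pos (by simp)]

/-- If the Cesàro averages of `b` diverge, so do those along some residue class. -/
theorem exists_residue_not_tendsto_average {b : ℕ → ℝ} {M : ℕ} (hM : 0 < M)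
    (hb : ¬ ∃ L : ℝ, Tendsto (fun n : ℕ => (∑ k ∈ Finset.range n, b k) / n) atTop (𝓝 L)) :
    ∃ r, ¬ ∃ L : ℝ, Tendsto
      (fun n : ℕ => (∑ k ∈ Finset.range n, if k % M = r then b k else 0) / n) atTop (𝓝 L) := by
  by_contra! h
  choose L hL using h
  refine hb ⟨∑ r ∈ Finset.range M, L r, (tendsto_finsetSum _ fun r _ => hL r).congr fun n => ?_⟩
  rw [← Finset.sum_div, Finset.sum_comm]
  congr 1
  refine Finset.sum_congr rfl fun k _ => ?_
  rw [Finset.sum_ite_eq, if_pos (Finset.mem_range.2 (Nat.mod_lt k hM))]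

theorem FreqReg.tendsto_average {N : ℕ} {w : ℕ → Fin N} {q : Fin N → ℝ} (hw : FreqReg w q)
    (h : Fin N → ℝ) :
    Tendsto (fun n : ℕ => (∑ k ∈ Finset.range n, h (w k)) / n) atTop (𝓝 (∑ j, q j * h j)) := by
  have h1 : Tendsto (fun n : ℕ => (∑ k ∈ Finset.range (n + 1), h (w k)) / n) atTop
      (𝓝 (∑ j, q j * h j)) := by
    refine (tendsto_finsetSum _ fun j _ => (hw j).mul_const (h j)).congr fun n => ?_
    simp_rw [div_mul_eq_mul_div]
    rw [← Finset.sum_div, ← Finset.sum_fiberwise _ w]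
    congr 1
    refine Finset.sum_congr rfl fun j _ => ?_
    rw [Finset.sum_congr rfl (g := fun _ => h j) (by simp +contextual), Finset.sum_const,
      nsmul_eq_mul]
  have h2 : Tendsto (fun n : ℕ => h (w n) / n) atTop (𝓝 0) := by
    refine squeeze_zero_norm (a := fun n : ℕ => (∑ j, |h j|) / n) (fun n => ?_)
      (tendsto_const_div_atTop_nhds_zero_nat _)
    rw [Real.norm_eq_abs, abs_div, Nat.abs_cast]
    gcongr
    exact Finset.single_le_sum (f := fun j => |h j|) (fun j _ => abs_nonneg _) (Finset.mem_univ _)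
  have h3 := h1.sub h2
  rw [sub_zero] at h3
  refine h3.congr fun n => ?_
  rw [Finset.sum_range_succ]
  ring

/-- The sequence `x` with its entries at the places congruent to `r` modulo `M` replaced by
those of `u`. -/
def overwrite {α : Type*} (M r : ℕ) (u x : ℕ → α) : ℕ → α :=
  fun k => if k % M = r then u k else x k

theorem card_filter_mod_ne (M r n : ℕ) :
    n ≤ ((Finset.range n).filter (fun k => ¬ k % M = r)).card + (n / M + 1) := by
  have h : ((Finset.range n).filter (fun k => k % M = r)).card ≤ n / M + 1 := by
    rw [← Finset.card_range (n / M + 1)]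
    refine Finset.card_le_card_of_injOn (fun k => k / M) ?_ ?_
    · intro k hk
      simp only [Finset.coe_filter, Finset.mem_range, mem_ofPred_eq] at hk
      simp only [Finset.coe_range, mem_Iio]
      exact Nat.lt_succ_of_le (Nat.div_le_div_right hk.1.le)
    · intro k hk l hl hkl
      simp only [Finset.coe_filter, Finset.mem_range, mem_ofPred_eq] at hk hl
      rw [← Nat.div_add_mod k M, ← Nat.div_add_mod l M, hk.2, hl.2]
      simp only at hkl
      rw [hkl]
  have := Finset.card_filter_add_card_filter_not (s := Finset.range n) (fun k => k % M = r)
  rw [Finset.card_range] at this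
  omega

/-- The uniform Bernoulli measure on the full shift. -/
noncomputable def uniformBernoulli (K : ℕ) [NeZero K] : Measure (ℕ → Fin K) :=
  Measure.infinitePi fun _ => (PMF.uniformOfFintype (Fin K)).toMeasure

instance (K : ℕ) [NeZero K] : IsProbabilityMeasure (uniformBernoulli K) := by
  unfold uniformBernoulli; infer_instance

theorem uniformBernoulli_overwrite_preimage_le {K : ℕ} [NeZero K] {M : ℕ} (r : ℕ)
    (u : ℕ → Fin K) (v : Word (Fin K)) :
    uniformBernoulli K (overwrite M r u ⁻¹' v.cylSet) ≤
      ENNReal.ofReal (K * Real.exp (-((1 - 1 / M) * Real.log K) * v.len)) := by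
  obtain ⟨n, v⟩ := v
  set s := (Finset.range n).filter (fun k => ¬ k % M = r)
  set t : ℕ → Set (Fin K) := fun k => if h : k < n then {v ⟨k, h⟩} else univ
  have hsub : overwrite M r u ⁻¹' (Word.cylSet ⟨n, v⟩) ⊆ Set.pi s t := by
    intro x hx k hk
    simp only [s, Finset.coe_filter, Finset.mem_range, mem_ofPred_eq] at hk
    have := hx ⟨k, hk.1⟩
    simp only [overwrite, if_neg hk.2] at this
    simp [t, hk.1, this]
  have hK : (0 : ℝ) < K := Nat.cast_pos.2 (NeZero.pos K)
  have hmes : uniformBernoulli K (Set.pi s t) = (K : ℝ≥0∞)⁻¹ ^ s.card := by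
    rw [uniformBernoulli, Measure.infinitePi_pi _ (fun _ _ => MeasurableSet.of_discrete),
      Finset.prod_congr rfl (g := fun _ => (K : ℝ≥0∞)⁻¹), Finset.prod_const]
    intro k hk
    have hk' : k < n := Finset.mem_range.1 (Finset.mem_filter.1 hk).1
    simp only [t, dif_pos hk']
    rw [PMF.toMeasure_apply_singleton _ _ (MeasurableSet.singleton _)]
    simp
  refine (measure_mono hsub).trans ?_
  rw [hmes, ← ENNReal.ofReal_natCast, ← ENNReal.ofReal_inv_of_pos hK,
    ← ENNReal.ofReal_pow (by positivity)]
  refine ENNReal.ofReal_le_ofReal ?_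
  have hlog : 0 ≤ Real.log K := Real.log_natCast_nonneg K
  have hcard : (n : ℝ) ≤ s.card + (n / M + 1) := by
    have h1 : (n : ℝ) ≤ s.card + ((n / M : ℕ) + 1) := by
      exact_mod_cast card_filter_mod_ne M r n
    have h2 : ((n / M : ℕ) : ℝ) ≤ n / M := Nat.cast_div_le
    linarith
  have e1 : (K : ℝ)⁻¹ ^ s.card = Real.exp (-(s.card * Real.log K)) := by
    rw [Real.exp_neg, Real.exp_nat_mul, Real.exp_log hK, inv_pow]
  rw [e1]
  nth_rewrite 2 [← Real.exp_log hK]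
  rw [← Real.exp_add]
  refine Real.exp_le_exp.2 ?_
  have := mul_le_mul_of_nonneg_right hcard hlog
  change _ ≤ Real.log K + -((1 - 1 / M) * Real.log K) * n
  have e2 : (1 / M : ℝ) * n = n / M := by ring
  nlinarith

instance {α : Type*} [Countable α] : Countable (Word α) :=
  inferInstanceAs (Countable (Σ n : ℕ, Fin n → α))

theorem Hentm_eq_top_of_overwrite {K : ℕ} [NeZero K] {M : ℕ} {r : ℕ}
    {u₀ u₁ : ℕ → Fin K} {D : Set (ℕ → Fin K)}
    (hD : ∀ x, overwrite M r u₀ x ∈ D ∨ overwrite M r u₁ x ∈ D) {s : ℝ}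
    (hs : s < (1 - 1 / M) * Real.log K) : Hentm D s = ⊤ := by
  set t := (1 - 1 / M) * Real.log K
  have hK : (0 : ℝ) < K := Nat.cast_pos.2 (NeZero.pos K)
  have hcover : ∀ S : Set (Word (Fin K)), D ⊆ ⋃ v ∈ S, v.cylSet →
      1 ≤ ENNReal.ofReal (2 * K) *
        ∑' v : S, ENNReal.ofReal (Real.exp (-t * ((v : Word (Fin K)).len : ℝ))) := by
    intro S hS
    have hpre : ∀ u : ℕ → Fin K, uniformBernoulli K (overwrite M r u ⁻¹' D) ≤
        ENNReal.ofReal K *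
          ∑' v : S, ENNReal.ofReal (Real.exp (-t * ((v : Word (Fin K)).len : ℝ))) := by
      intro u
      calc uniformBernoulli K (overwrite M r u ⁻¹' D)
          ≤ uniformBernoulli K (⋃ v ∈ S, overwrite M r u ⁻¹' v.cylSet) := by
            refine measure_mono ?_
            rw [← preimage_iUnion₂]
            exact preimage_mono hS
        _ ≤ ∑' v : S, uniformBernoulli K (overwrite M r u ⁻¹' (v : Word (Fin K)).cylSet) :=
            measure_biUnion_le _ S.to_countable _
        _ ≤ ∑' v : S, ENNReal.ofReal (K * Real.exp (-t * (v : Word (Fin K)).len)) :=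
            ENNReal.tsum_le_tsum fun v => uniformBernoulli_overwrite_preimage_le r u v
        _ = _ := by
            rw [← ENNReal.tsum_mul_left]
            exact tsum_congr fun v => ENNReal.ofReal_mul hK.le
    have huniv : (univ : Set (ℕ → Fin K)) ⊆ overwrite M r u₀ ⁻¹' D ∪ overwrite M r u₁ ⁻¹' D :=
      fun x _ => hD x
    calc (1 : ℝ≥0∞) = uniformBernoulli K univ := measure_univ.symm
      _ ≤ _ := (measure_mono huniv).trans (measure_union_le _ _)
      _ ≤ _ := add_le_add (hpre u₀) (hpre u₁)
      _ = _ := by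
          rw [← two_mul, ← mul_assoc, ENNReal.ofReal_mul zero_le_two, ENNReal.ofReal_ofNat]
  have hlow : ∀ n : ℕ, ENNReal.ofReal ((2 * K : ℝ)⁻¹ * Real.exp ((t - s) * n)) ≤ Hsr D s n := by
    intro n
    refine le_iInf fun S => le_iInf fun hlen => le_iInf fun hS => ?_
    calc ENNReal.ofReal ((2 * K : ℝ)⁻¹ * Real.exp ((t - s) * n))
        = ENNReal.ofReal ((2 * K : ℝ)⁻¹ * Real.exp ((t - s) * n)) * 1 := (mul_one _).symm
      _ ≤ _ := mul_le_mul_right (hcover S hS) _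
      _ = ∑' v : S, ENNReal.ofReal (Real.exp ((t - s) * n)) *
            ENNReal.ofReal (Real.exp (-t * ((v : Word (Fin K)).len : ℝ))) := by
          rw [← mul_assoc, ← ENNReal.ofReal_mul (by positivity), ENNReal.tsum_mul_left]
          congr 2
          field_simp
      _ ≤ _ := by
          refine ENNReal.tsum_le_tsum fun v => ?_
          rw [← ENNReal.ofReal_mul (Real.exp_pos _).le, ← Real.exp_add]
          refine ENNReal.ofReal_le_ofReal (Real.exp_le_exp.2 ?_)
          have : (n : ℝ) ≤ (v : Word (Fin K)).len := Nat.cast_le.2 (hlen v v.2).le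
          nlinarith
  have htend : Tendsto (fun n : ℕ => ENNReal.ofReal ((2 * K : ℝ)⁻¹ * Real.exp ((t - s) * n))) atTop
      (𝓝 ⊤) := by
    refine ENNReal.tendsto_ofReal_atTop.comp (Tendsto.const_mul_atTop (by positivity) ?_)
    exact Real.tendsto_exp_atTop.comp
      (Tendsto.const_mul_atTop (sub_pos.2 hs) tendsto_natCast_atTop_atTop)
  exact top_le_iff.1 (le_of_tendsto' htend fun n => (hlow n).trans (le_iSup (Hsr D s) n))

theorem Hentm_log_ne_top {K : ℕ} [NeZero K] (D : Set (ℕ → Fin K)) :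
    Hentm D (Real.log K) ≠ ⊤ := by
  have hK : (0 : ℝ) < K := Nat.cast_pos.2 (NeZero.pos K)
  refine ne_top_of_le_ne_top ENNReal.one_ne_top (iSup_le fun r => ?_)
  let e : (Fin (r + 1) → Fin K) → Word (Fin K) := fun v => ⟨r + 1, v⟩
  have he : Function.Injective e := fun v v' h => eq_of_heq (Sigma.mk.inj h).2
  refine (iInf₂_le_of_le (range e) ?_ (iInf_le_of_le ?_ le_rfl)).trans ?_
  · rintro _ ⟨v, rfl⟩
    exact Nat.lt_succ_self r
  · intro x _
    exact mem_biUnion (mem_range_self fun k : Fin (r + 1) => x k) fun _ => rfl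
  · rw [tsum_range (fun v : Word (Fin K) => ENNReal.ofReal (Real.exp (-Real.log K * v.len))) he,
      tsum_fintype]
    have : ∀ v, Real.exp (-Real.log K * (e v).len) = ((K : ℝ) ^ (r + 1))⁻¹ := by
      intro v
      rw [neg_mul, Real.exp_neg, mul_comm, Real.exp_nat_mul, Real.exp_log hK]
      rfl
    simp_rw [this]
    rw [Finset.sum_const, ← ENNReal.ofReal_nsmul]
    simp [hK.ne']

theorem freq_regular_irregular_set_full_entropy
    {N K : ℕ} (q : Fin N → ℝ) (hq : ProbVec q)
    (w : ℕ → Fin N) (hw : FreqReg w q)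
    (f : Fin N → Fin K → ℝ)
    (hg : ∃ i₁ i₂ : Fin K, (∑ j, q j * f j i₁) ≠ (∑ j, q j * f j i₂)) :
    htop {x : ℕ → Fin K |
        ¬ ∃ α : ℝ, Tendsto (fun n : ℕ => (∑ k ∈ Finset.range n, f (w k) (x k)) / n)
          atTop (nhds α)} = ((Real.log K : ℝ) : EReal) := by
  obtain ⟨i₁, i₂, hne⟩ := hg
  have : NeZero K := ⟨by rintro rfl; exact i₁.elim0⟩
  set D := {x : ℕ → Fin K |
        ¬ ∃ α : ℝ, Tendsto (fun n : ℕ => (∑ k ∈ Finset.range n, f (w k) (x k)) / n)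
          atTop (nhds α)} with hDdef
  have hδ : ∑ j, q j * (f j i₁ - f j i₂) ≠ 0 := by
    simp_rw [mul_sub]
    rw [Finset.sum_sub_distrib]
    exact sub_ne_zero.2 hne
  have hdyadic := not_tendsto_average_dyadic hδ (hw.tendsto_average fun j => f j i₁ - f j i₂)
  have hmain : ∀ M : ℕ, 0 < M → ∃ r, ∃ u₀ u₁ : ℕ → Fin K,
      ∀ x, overwrite M r u₀ x ∈ D ∨ overwrite M r u₁ x ∈ D := by
    intro M hM
    obtain ⟨r, hr⟩ := exists_residue_not_tendsto_average hM hdyadic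
    refine ⟨r, fun _ => i₁, fun k => if Even (Nat.log 2 k) then i₂ else i₁, fun x => ?_⟩
    by_contra! h
    obtain ⟨h₀, h₁⟩ := h
    simp only [hDdef, mem_ofPred_eq, not_not] at h₀ h₁
    obtain ⟨α, hα⟩ := h₀
    obtain ⟨β, hβ⟩ := h₁
    refine hr ⟨α - β, (hα.sub hβ).congr fun n => ?_⟩
    rw [← sub_div, ← Finset.sum_sub_distrib]
    congr 1
    refine Finset.sum_congr rfl fun k _ => ?_
    unfold overwrite
    split_ifs <;> simp [*]
  have hDne : D ≠ ∅ := by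
    obtain ⟨r, u₀, u₁, h⟩ := hmain 1 one_pos
    rcases h fun _ => i₁ with h | h <;> exact Set.Nonempty.ne_empty ⟨_, h⟩
  rw [htop, if_neg hDne]
  congr 1
  refine IsLeast.csInf_eq ⟨⟨Real.log_natCast_nonneg K, Hentm_log_ne_top D⟩, ?_⟩
  rintro s ⟨-, hs⟩
  by_contra! hlt
  have hlim : Tendsto (fun n : ℕ => (1 - 1 / (n : ℝ)) * Real.log K) atTop
      (𝓝 ((1 - 0) * Real.log K)) :=
    (tendsto_const_nhds.sub tendsto_one_div_atTop_nhds_zero_nat).mul_const _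
  rw [sub_zero, one_mul] at hlim
  obtain ⟨M, hM, hM0⟩ := ((hlim.eventually_const_lt hlt).and (eventually_gt_atTop 0)).exists
  obtain ⟨r, u₀, u₁, h⟩ := hmain M hM0
  exact hs (Hentm_eq_top_of_overwrite h hM)
end

section
/- Let Σ_A ⊆ Σ be an aperiodic and irreducible subshift of finite type and let (φ_i)_{i∈ℕ} be continuous potentials on Σ_A with uniformly decreasing variations. If L_A(α) ≠ ∅, then for every δ > 0 there exists a nonempty set M ⊆ L_A(α) such that h_top(M) > h_top(L_A(α)) − δ and the convergence (1/n) Σ_{k=0}^{n−1} φ_k(σ^k 𝐢) → α is uniform on M. -/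
open Filter Set
open scoped ENNReal

/-- `L_A(α)` described via convergence of the Birkhoff averages. -/
def LAlim {K : ℕ} (M : Fin K → Fin K → Bool) (φ : ℕ → (ℕ → Fin K) → ℝ) (a : ℝ) :
    Set (ℕ → Fin K) :=
  {x | x ∈ SigmaA M ∧ Tendsto (fun n => birk φ n x) atTop (nhds a)}

namespace Word

variable {α : Type*}

/-- A tuple of symbols, viewed as a word. -/
def ofFn {n : ℕ} (w : Fin n → α) : Word α := ⟨n, w⟩

theorem ofFn_injective (n : ℕ) : Function.Injective (ofFn : (Fin n → α) → Word α) :=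
  fun _ _ h => eq_of_heq (Sigma.mk.inj h).2

/-- The word formed by the first `m` symbols of `x`. -/
def pre (x : ℕ → α) (m : ℕ) : Word α := ⟨m, fun k => x k⟩

theorem mem_cylSet_iff {w : Word α} {x : ℕ → α} : x ∈ w.cylSet ↔ w = pre x w.len := by
  obtain ⟨n, w⟩ := w
  constructor
  · intro h
    have hw : w = fun k : Fin n => x k := funext fun k => (h k).symm
    subst hw
    rfl
  · intro h
    have hw : w = fun k : Fin n => x k := eq_of_heq (Sigma.mk.inj h).2
    intro k
    rw [hw]

theorem mem_cylSet_pre (x : ℕ → α) (m : ℕ) : x ∈ (pre x m).cylSet := fun _ => rfl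

theorem cylSet_pre_subset (x : ℕ → α) {m n : ℕ} (h : m ≤ n) :
    (pre x n).cylSet ⊆ (pre x m).cylSet :=
  fun _ hy k => hy ⟨k, k.2.trans_le h⟩

/-- The weight `∑ e^{-s·l(C)}` of a family of cylinders. -/
noncomputable def cost (s : ℝ) (S : Set (Word α)) : ℝ≥0∞ :=
  ∑' w : S, ENNReal.ofReal (Real.exp (-s * ((w : Word α).len : ℝ)))

theorem cost_mono (s : ℝ) {S T : Set (Word α)} (h : S ⊆ T) : cost s S ≤ cost s T :=
  ENNReal.tsum_mono_subtype (fun w : Word α => ENNReal.ofReal (Real.exp (-s * (w.len : ℝ)))) h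

theorem cost_union_of_disjoint (s : ℝ) {S T : Set (Word α)} (h : Disjoint S T) :
    cost s (S ∪ T) = cost s S + cost s T :=
  ENNReal.summable.tsum_union_disjoint
    (f := fun w : Word α => ENNReal.ofReal (Real.exp (-s * (w.len : ℝ)))) h ENNReal.summable

theorem cost_union_add_cost_inter (s : ℝ) (S T : Set (Word α)) :
    cost s (S ∪ T) + cost s (S ∩ T) = cost s S + cost s T := by
  have h₁ : cost s (S ∪ T) = cost s S + cost s (T \ S) := by
    rw [← Set.union_sdiff_self]
    exact cost_union_of_disjoint s Set.disjoint_sdiff_right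
  have h₂ : cost s T = cost s (T \ S) + cost s (S ∩ T) := by
    conv_lhs => rw [← Set.sdiff_union_inter T S, Set.inter_comm T S]
    exact cost_union_of_disjoint s (Set.disjoint_left.2 fun _ h h' => h.2 h'.1)
  rw [h₁, h₂, add_assoc]

/-- The words of `S` whose cylinders are maximal among the cylinders of `S`. -/
def shortest (S : Set (Word α)) : Set (Word α) :=
  {w ∈ S | ∀ v ∈ S, w.cylSet ⊆ v.cylSet → w.len ≤ v.len}

theorem exists_mem_shortest {S : Set (Word α)} {w : Word α} (hw : w ∈ S) {x : ℕ → α}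
    (hx : x ∈ w.cylSet) : ∃ m ≤ w.len, pre x m ∈ shortest S := by
  classical
  have hex : ∃ m, pre x m ∈ S := ⟨w.len, mem_cylSet_iff.1 hx ▸ hw⟩
  refine ⟨Nat.find hex, Nat.find_min' hex (mem_cylSet_iff.1 hx ▸ hw), Nat.find_spec hex, ?_⟩
  intro v hv hsub
  have hxv := mem_cylSet_iff.1 (hsub (mem_cylSet_pre x _))
  exact Nat.find_min' hex (hxv ▸ hv)

/-- Fatou's lemma for weights of families of cylinders. -/
theorem cost_eventually_le (s : ℝ) (V : ℕ → Set (Word α)) {c : ℝ≥0∞}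
    (h : ∀ n, cost s (V n) ≤ c) : cost s {w | ∀ᶠ n in atTop, w ∈ V n} ≤ c := by
  rw [cost, ENNReal.tsum_eq_iSup_sum]
  refine iSup_le fun F => ?_
  have hF : ∀ᶠ n in atTop, ∀ w ∈ F, (w : Word α) ∈ V n :=
    (Filter.eventually_all_finset F).2 fun w _ => w.2
  obtain ⟨n, hn⟩ := hF.exists
  refine le_trans ?_ (h n)
  calc ∑ w ∈ F, ENNReal.ofReal (Real.exp (-s * ((w : Word α).len : ℝ)))
      = cost s ((F.map (Function.Embedding.subtype _) : Finset (Word α)) : Set (Word α)) := by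
        rw [cost, Finset.tsum_subtype' _
          (fun w : Word α => ENNReal.ofReal (Real.exp (-s * (w.len : ℝ)))), Finset.sum_map]
        rfl
    _ ≤ cost s (V n) := by
        refine cost_mono s fun w hw => ?_
        obtain ⟨v, hv, rfl⟩ := Finset.mem_map.1 (Finset.mem_coe.1 hw)
        exact hn v hv

end Word

section Content

variable {α : Type*}

theorem Hsr_le_cost {E : Set (ℕ → α)} (s : ℝ) {r : ℕ} {S : Set (Word α)}
    (hr : ∀ w ∈ S, r < w.len) (hE : E ⊆ ⋃ w ∈ S, w.cylSet) : Hsr E s r ≤ Word.cost s S :=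
  iInf₂_le_of_le S hr (iInf_le _ hE)

theorem le_Hsr {E : Set (ℕ → α)} {s : ℝ} {r : ℕ} {c : ℝ≥0∞}
    (h : ∀ S : Set (Word α), (∀ w ∈ S, r < w.len) → E ⊆ ⋃ w ∈ S, w.cylSet →
      c ≤ Word.cost s S) : c ≤ Hsr E s r :=
  le_iInf₂ fun S hr => le_iInf fun hE => h S hr hE

theorem Hsr_mono {E F : Set (ℕ → α)} (s : ℝ) (r : ℕ) (h : E ⊆ F) : Hsr E s r ≤ Hsr F s r :=
  le_Hsr fun _ hr hF => Hsr_le_cost s hr (h.trans hF)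

theorem Hsr_mono_level (E : Set (ℕ → α)) (s : ℝ) {r R : ℕ} (h : r ≤ R) :
    Hsr E s r ≤ Hsr E s R :=
  le_Hsr fun _ hr hE => Hsr_le_cost s (fun w hw => h.trans_lt (hr w hw)) hE

theorem Hsr_empty (s : ℝ) (r : ℕ) : Hsr (∅ : Set (ℕ → α)) s r = 0 := by
  refine le_antisymm ?_ bot_le
  refine (Hsr_le_cost (S := ∅) s (by simp) (by simp)).trans ?_
  simp [Word.cost]

theorem exists_cover_cost_le {E : Set (ℕ → α)} {s : ℝ} {r : ℕ} (hfin : Hsr E s r ≠ ⊤)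
    {ε : ℝ≥0∞} (hε : ε ≠ 0) : ∃ S : Set (Word α), (∀ w ∈ S, r < w.len) ∧
      E ⊆ ⋃ w ∈ S, w.cylSet ∧ Word.cost s S ≤ Hsr E s r + ε := by
  by_contra! H
  have h : Hsr E s r + ε ≤ Hsr E s r := le_Hsr fun S hr hE => (H S hr hE).le
  exact (ENNReal.lt_add_right hfin hε).not_ge h

/-- Strong subadditivity of the net content, at the level of covers. -/
theorem cost_shortest_union_add_Hsr_inter_le {A B : Set (ℕ → α)} (s : ℝ) {r : ℕ}
    {V U : Set (Word α)} (hV : ∀ w ∈ V, r < w.len) (hU : ∀ w ∈ U, r < w.len)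
    (hA : A ⊆ ⋃ w ∈ V, w.cylSet) (hB : B ⊆ ⋃ w ∈ U, w.cylSet) :
    Word.cost s (Word.shortest (V ∪ U)) + Hsr (A ∩ B) s r ≤ Word.cost s V + Word.cost s U := by
  set W := Word.shortest (V ∪ U)
  have hWsub : W ⊆ V ∪ U := fun w hw => hw.1
  have hcover : A ∩ B ⊆ ⋃ w ∈ ((V ∪ U) \ W) ∪ (V ∩ U), w.cylSet := by
    rintro x ⟨hxA, hxB⟩
    obtain ⟨v, hv, hxv⟩ := mem_iUnion₂.1 (hA hxA)
    obtain ⟨u, hu, hxu⟩ := mem_iUnion₂.1 (hB hxB)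
    have hv' := Word.mem_cylSet_iff.1 hxv
    have hu' := Word.mem_cylSet_iff.1 hxu
    rcases lt_trichotomy v.len u.len with h | h | h
    · refine mem_iUnion₂.2 ⟨u, Or.inl ⟨Or.inr hu, fun hmem => ?_⟩, hxu⟩
      refine (hmem.2 v (Or.inl hv) ?_).not_gt h
      rw [hv', hu']
      exact Word.cylSet_pre_subset x h.le
    · have huv : v = u := by rw [hv', hu', h]
      exact mem_iUnion₂.2 ⟨v, Or.inr ⟨hv, huv ▸ hu⟩, hxv⟩
    · refine mem_iUnion₂.2 ⟨v, Or.inl ⟨Or.inl hv, fun hmem => ?_⟩, hxv⟩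
      refine (hmem.2 u (Or.inr hu) ?_).not_gt h
      rw [hv', hu']
      exact Word.cylSet_pre_subset x h.le
  have hlen : ∀ w ∈ ((V ∪ U) \ W) ∪ (V ∩ U), r < w.len := by
    rintro w (⟨hw | hw, -⟩ | hw)
    exacts [hV w hw, hU w hw, hV w hw.1]
  have hsplit : Word.cost s W + Word.cost s ((V ∪ U) \ W) = Word.cost s (V ∪ U) := by
    rw [← Word.cost_union_of_disjoint s Set.disjoint_sdiff_right, Set.union_sdiff_cancel hWsub]
  have hunion : Word.cost s (((V ∪ U) \ W) ∪ (V ∩ U)) ≤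
      Word.cost s ((V ∪ U) \ W) + Word.cost s (V ∩ U) := by
    rw [← Word.cost_union_add_cost_inter]
    exact le_self_add
  calc Word.cost s W + Hsr (A ∩ B) s r
      ≤ Word.cost s W + (Word.cost s ((V ∪ U) \ W) + Word.cost s (V ∩ U)) := by
        gcongr
        exact (Hsr_le_cost s hlen hcover).trans hunion
    _ = Word.cost s V + Word.cost s U := by
        rw [← add_assoc, hsplit, Word.cost_union_add_cost_inter]

/-- The increasing sets lemma for net contents: no measurability is required. -/
theorem Hsr_iUnion_le {E : ℕ → Set (ℕ → α)} (hE : Monotone E) (s : ℝ) (r : ℕ) :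
    Hsr (⋃ n, E n) s r ≤ ⨆ n, Hsr (E n) s r := by
  by_cases hfin : ∀ n, Hsr (E n) s r ≠ ⊤
  swap
  · push Not at hfin
    obtain ⟨n, hn⟩ := hfin
    exact le_top.trans (hn ▸ le_iSup (fun n => Hsr (E n) s r) n)
  refine ENNReal.le_of_forall_pos_le_add fun ε hε _ => ?_
  obtain ⟨e, he, hsum⟩ := ENNReal.exists_pos_sum_of_countable'
    (ENNReal.coe_pos.2 hε).ne' ℕ
  choose U hUr hUE hUc using fun n => exists_cover_cost_le (hfin n) (he n).ne'
  let V : ℕ → Set (Word α) := fun n =>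
    Nat.rec (U 0) (fun n S => Word.shortest (S ∪ U (n + 1))) n
  have hVsucc : ∀ n, V (n + 1) = Word.shortest (V n ∪ U (n + 1)) := fun _ => rfl
  have hVr : ∀ n, ∀ w ∈ V n, r < w.len := by
    intro n
    induction n with
    | zero => exact hUr 0
    | succ n ih =>
      intro w hw
      rcases hw.1 with h | h
      exacts [ih w h, hUr _ w h]
  have hVE : ∀ n, E n ⊆ ⋃ w ∈ V n, w.cylSet := by
    intro n
    cases n with
    | zero => exact hUE 0
    | succ n =>
      intro x hx
      obtain ⟨u, hu, hxu⟩ := mem_iUnion₂.1 (hUE _ hx)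
      obtain ⟨m, -, hm⟩ := Word.exists_mem_shortest (S := V n ∪ U (n + 1)) (Or.inr hu) hxu
      exact mem_iUnion₂.2 ⟨_, hm, Word.mem_cylSet_pre x m⟩
  have hVc : ∀ n, Word.cost s (V n) ≤ Hsr (E n) s r + ∑ k ∈ Finset.range (n + 1), e k := by
    intro n
    induction n with
    | zero => simpa using show Word.cost s (V 0) ≤ _ from hUc 0
    | succ n ih =>
      have h := cost_shortest_union_add_Hsr_inter_le s (hVr n) (hUr (n + 1)) (hVE n)
        (hUE (n + 1))
      rw [Set.inter_eq_left.2 (hE n.le_succ), ← hVsucc] at h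
      refine (ENNReal.add_le_add_iff_right (hfin n)).1 (h.trans ?_)
      calc Word.cost s (V n) + Word.cost s (U (n + 1))
          ≤ (Hsr (E n) s r + ∑ k ∈ Finset.range (n + 1), e k) +
            (Hsr (E (n + 1)) s r + e (n + 1)) := add_le_add ih (hUc (n + 1))
        _ = Hsr (E (n + 1)) s r + ∑ k ∈ Finset.range (n + 1 + 1), e k + Hsr (E n) s r := by
          rw [Finset.sum_range_succ _ (n + 1)]
          ring
  have hcost : Word.cost s {w | ∀ᶠ n in atTop, w ∈ V n} ≤ (⨆ n, Hsr (E n) s r) + ε :=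
    Word.cost_eventually_le s V fun n => (hVc n).trans <| by
      gcongr
      · exact le_iSup (fun n => Hsr (E n) s r) n
      · exact (ENNReal.sum_le_tsum _).trans hsum.le
  refine (Hsr_le_cost (S := {w | ∀ᶠ n in atTop, w ∈ V n}) s ?_ ?_).trans hcost
  · intro w hw
    obtain ⟨n, hn⟩ := Filter.Eventually.exists hw
    exact hVr n w hn
  · intro x hx
    obtain ⟨n₀, hn₀⟩ := mem_iUnion.1 hx
    have hex : ∃ m, ∃ n ≥ n₀, Word.pre x m ∈ V n := by
      obtain ⟨w, hw, hxw⟩ := mem_iUnion₂.1 (hVE n₀ hn₀)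
      exact ⟨w.len, n₀, le_rfl, Word.mem_cylSet_iff.1 hxw ▸ hw⟩
    obtain ⟨m₀, ⟨n, hn, hmem⟩, hmin⟩ : ∃ m₀, (∃ n ≥ n₀, Word.pre x m₀ ∈ V n) ∧
        ∀ m, (∃ n ≥ n₀, Word.pre x m ∈ V n) → m₀ ≤ m :=
      by classical exact ⟨Nat.find hex, Nat.find_spec hex, fun m hm => Nat.find_min' hex hm⟩
    refine mem_iUnion₂.2 ⟨Word.pre x m₀, ?_, Word.mem_cylSet_pre x _⟩
    refine eventually_atTop.2 ⟨n, fun k hk => ?_⟩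
    induction k, hk using Nat.le_induction with
    | base => exact hmem
    | succ k hk ih =>
      obtain ⟨m, hm, hm'⟩ := Word.exists_mem_shortest (S := V k ∪ U (k + 1)) (Or.inl ih)
        (Word.mem_cylSet_pre x _)
      have hle := hmin m ⟨k + 1, by lia, hm'⟩
      have hm_eq : m = m₀ := le_antisymm hm hle
      exact hm_eq ▸ hm'

theorem isOpen_cylSet [TopologicalSpace α] [DiscreteTopology α] (w : Word α) :
    IsOpen w.cylSet := by
  have h : w.cylSet = ⋂ k : Fin w.1, (fun x : ℕ → α => x k) ⁻¹' {w.2 k} := by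
    ext x
    simp [Word.cylSet, cyl]
  rw [h]
  exact isOpen_iInter_of_finite fun k => (isOpen_discrete _).preimage (continuous_apply _)

/-- The net content is continuous along decreasing sequences of compact sets. -/
theorem le_Hsr_iInter [TopologicalSpace α] [DiscreteTopology α] [Finite α]
    {F : ℕ → Set (ℕ → α)} (hF : Antitone F) (hclosed : ∀ n, IsClosed (F n)) {s : ℝ} {r : ℕ}
    {c : ℝ≥0∞} (hc : ∀ n, c ≤ Hsr (F n) s r) : c ≤ Hsr (⋂ n, F n) s r := by
  refine le_Hsr fun S hr hS => ?_
  have hopen : IsOpen (⋃ w ∈ S, w.cylSet) := isOpen_biUnion fun w _ => isOpen_cylSet w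
  obtain ⟨n, hn⟩ := exists_subset_nhds_of_compactSpace hF.directed_ge hclosed
    fun x hx => hopen.mem_nhds (hS hx)
  exact (hc n).trans (Hsr_le_cost s hr hn)

/-- An Egorov-type theorem for net contents: if `L` is covered by each of the increasing
sequences of closed sets `G j`, the intersection of suitable members has content at least `c`. -/
theorem exists_le_Hsr_iInter [TopologicalSpace α] [DiscreteTopology α] [Finite α]
    {L : Set (ℕ → α)} {G : ℕ → ℕ → Set (ℕ → α)} (hG : ∀ j, Monotone (G j))
    (hclosed : ∀ j N, IsClosed (G j N)) (hL : ∀ j, L ⊆ ⋃ N, G j N) {s : ℝ} {r : ℕ}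
    {c : ℝ≥0∞} (hc : c < Hsr L s r) : ∃ N : ℕ → ℕ, c ≤ Hsr (⋂ j, G j (N j)) s r := by
  have step : ∀ (j : ℕ) (E : {E : Set (ℕ → α) // E ⊆ L ∧ c < Hsr E s r}),
      ∃ N, c < Hsr (E.1 ∩ G j N) s r := by
    rintro j ⟨E, hEL, hE⟩
    refine lt_iSup_iff.1 (hE.trans_le ?_)
    refine le_trans (Hsr_mono s r ?_)
      (Hsr_iUnion_le (E := fun N => E ∩ G j N) (fun a b h => inter_subset_inter_right _ (hG j h))
        s r)
    rw [← inter_iUnion]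
    exact subset_inter subset_rfl (hEL.trans (hL j))
  choose f hf using step
  let E : ℕ → {E : Set (ℕ → α) // E ⊆ L ∧ c < Hsr E s r} := fun n =>
    Nat.rec ⟨L, subset_rfl, hc⟩
      (fun j E => ⟨E.1 ∩ G j (f j E), inter_subset_left.trans E.2.1, hf j E⟩) n
  have hsub : ∀ n, (E n).1 ⊆ ⋂ j, ⋂ (_ : j < n), G j (f j (E j)) := by
    intro n
    induction n with
    | zero => simp
    | succ n ih =>
      rintro x ⟨hx, hx'⟩
      refine mem_iInter₂.2 fun j hj => ?_
      rcases Nat.lt_succ_iff_lt_or_eq.1 hj with h | rfl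
      exacts [mem_iInter₂.1 (ih hx) j h, hx']
  refine ⟨fun j => f j (E j), ?_⟩
  have h := le_Hsr_iInter (F := fun n => ⋂ j, ⋂ (_ : j < n), G j (f j (E j)))
    (fun a b hab => iInter_mono fun j => iInter_mono' fun hj => ⟨hj.trans_le hab, subset_rfl⟩)
    (fun n => isClosed_iInter fun j => isClosed_iInter fun _ => hclosed _ _)
    (fun n => (E n).2.2.le.trans (Hsr_mono s r (hsub n)))
  refine h.trans (Hsr_mono s r fun x hx => ?_)
  exact mem_iInter.2 fun j => mem_iInter₂.1 (mem_iInter.1 hx (j + 1)) j j.lt_succ_self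

theorem Hentm_eq_top_of_lt {E : Set (ℕ → α)} {s t : ℝ} {r : ℕ} (hts : t < s)
    (h : Hsr E s r ≠ 0) : Hentm E t = ⊤ := by
  have key : ∀ R ≥ r, ENNReal.ofReal (Real.exp ((s - t) * R)) * Hsr E s r ≤ Hentm E t := by
    intro R hR
    refine le_trans ?_ (le_iSup (fun r => Hsr E t r) R)
    refine le_trans (mul_le_mul_right (Hsr_mono_level E s hR) _) (le_Hsr fun S hr hE => ?_)
    refine (mul_le_mul_right (Hsr_le_cost s hr hE) _).trans ?_
    rw [Word.cost, ← ENNReal.tsum_mul_left]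
    refine ENNReal.tsum_le_tsum fun w => ?_
    rw [← ENNReal.ofReal_mul (Real.exp_pos _).le, ← Real.exp_add]
    refine ENNReal.ofReal_le_ofReal (Real.exp_le_exp.2 ?_)
    have hw : (R : ℝ) ≤ (w : Word α).len := by exact_mod_cast (hr w w.2).le
    nlinarith [mul_le_mul_of_nonneg_left hw (sub_pos.2 hts).le]
  have hlim : Tendsto (fun R : ℕ => ENNReal.ofReal (Real.exp ((s - t) * R)) * Hsr E s r) atTop
      (nhds (⊤ * Hsr E s r)) := by
    refine ENNReal.Tendsto.mul_const ?_ (Or.inl ENNReal.top_ne_zero)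
    exact ENNReal.tendsto_ofReal_nhds_top.2 <| Real.tendsto_exp_atTop.comp <|
      tendsto_natCast_atTop_atTop.const_mul_atTop (sub_pos.2 hts)
  rw [ENNReal.top_mul h] at hlim
  exact top_le_iff.1 (le_of_tendsto hlim (eventually_atTop.2 ⟨r, key⟩))

theorem exists_Hentm_ne_top [Fintype α] (E : Set (ℕ → α)) : ∃ s : ℝ, 0 ≤ s ∧ Hentm E s ≠ ⊤ := by
  refine ⟨Fintype.card α, Nat.cast_nonneg _, ne_top_of_le_ne_top ENNReal.one_ne_top
    (iSup_le fun r => ?_)⟩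
  let S : Set (Word α) := Set.range (Word.ofFn : (Fin (r + 1) → α) → Word α)
  have hS : ∀ w ∈ S, w.len = r + 1 := by
    rintro _ ⟨w, rfl⟩
    rfl
  refine (Hsr_le_cost (S := S) _ (fun w hw => by rw [hS w hw]; exact r.lt_succ_self)
    fun x _ => mem_iUnion₂.2 ⟨Word.pre x (r + 1), ⟨_, rfl⟩, Word.mem_cylSet_pre x _⟩).trans ?_
  have hsum := tsum_range (fun w : Word α =>
    ENNReal.ofReal (Real.exp (-(Fintype.card α : ℝ) * (w.len : ℝ)))) (Word.ofFn_injective (r + 1))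
  rw [Word.cost, hsum, tsum_fintype]
  have hterm : ∀ w : Fin (r + 1) → α,
      ENNReal.ofReal (Real.exp (-(Fintype.card α : ℝ) *
        ((Word.ofFn w).len : ℝ))) =
      ENNReal.ofReal (Real.exp (-(Fintype.card α : ℝ)) ^ (r + 1)) := by
    intro w
    rw [← Real.exp_nat_mul]
    congr 2
    exact mul_comm _ _
  simp only [hterm, Finset.sum_const, Finset.card_univ, Fintype.card_fun, Fintype.card_fin,
    nsmul_eq_mul]
  rw [← ENNReal.ofReal_natCast, ← ENNReal.ofReal_mul (Nat.cast_nonneg _), ENNReal.ofReal_le_one,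
    Nat.cast_pow, ← mul_pow]
  refine pow_le_one₀ (by positivity) ?_
  rw [Real.exp_neg, ← div_eq_mul_inv, div_le_one (Real.exp_pos _)]
  linarith [Real.add_one_le_exp (Fintype.card α : ℝ)]

theorem htop_eq_of_nonempty {E : Set (ℕ → α)} (h : E ≠ ∅) :
    htop E = ((sInf {s : ℝ | 0 ≤ s ∧ Hentm E s ≠ ⊤} : ℝ) : EReal) :=
  if_neg h

theorem le_htop_of_Hsr_ne_zero [Fintype α] {E : Set (ℕ → α)} {s : ℝ} {r : ℕ}
    (h : Hsr E s r ≠ 0) : (s : EReal) ≤ htop E := by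
  have hE : E ≠ ∅ := by
    rintro rfl
    exact h (Hsr_empty s r)
  rw [htop_eq_of_nonempty hE, EReal.coe_le_coe_iff]
  refine le_csInf (exists_Hentm_ne_top E) fun t ht => ?_
  by_contra! hts
  exact ht.2 (Hentm_eq_top_of_lt hts h)

theorem Hentm_eq_top_of_lt_htop {E : Set (ℕ → α)} {s : ℝ} (hE : E ≠ ∅) (hs : 0 ≤ s)
    (h : (s : EReal) < htop E) : Hentm E s = ⊤ := by
  rw [htop_eq_of_nonempty hE, EReal.coe_lt_coe_iff] at h
  by_contra hne
  exact notMem_of_lt_csInf h ⟨0, fun _ ht => ht.1⟩ ⟨hs, hne⟩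

theorem htop_nonneg {E : Set (ℕ → α)} (hE : E ≠ ∅) : 0 ≤ htop E := by
  rw [htop_eq_of_nonempty hE]
  exact EReal.coe_nonneg.2 (Real.sInf_nonneg fun _ ht => ht.1)

end Content

section Birkhoff

variable {K : ℕ} {M : Fin K → Fin K → Bool} {φ : ℕ → (ℕ → Fin K) → ℝ}

theorem isClosed_SigmaA (M : Fin K → Fin K → Bool) : IsClosed (SigmaA M) := by
  have h : SigmaA M = ⋂ k : ℕ, (fun x : ℕ → Fin K => (x k, x (k + 1))) ⁻¹'
      {p | M p.1 p.2 = true} := by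
    ext x
    simp [SigmaA]
  rw [h]
  exact isClosed_iInter fun k => (isClosed_discrete _).preimage (by fun_prop)

theorem mapsTo_shift_iterate_SigmaA (k : ℕ) : MapsTo (shift^[k]) (SigmaA M) (SigmaA M) :=
  MapsTo.iterate (fun x (hx : x ∈ SigmaA M) j => hx (j + 1)) k

theorem continuousOn_birk (hcont : ∀ i, ContinuousOn (φ i) (SigmaA M)) (n : ℕ) :
    ContinuousOn (birk φ n) (SigmaA M) := by
  have hshift : Continuous (shift : (ℕ → Fin K) → ℕ → Fin K) :=
    continuous_pi fun _ => continuous_apply _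
  refine ContinuousOn.div_const (continuousOn_finsetSum _ fun k _ => ?_) _
  exact (hcont k).comp (hshift.iterate k).continuousOn (mapsTo_shift_iterate_SigmaA k)

/-- The points of `Σ_A` whose Birkhoff averages are `1/(j+1)`-close to `a` from time `N` on. -/
def closeFrom (M : Fin K → Fin K → Bool) (φ : ℕ → (ℕ → Fin K) → ℝ) (a : ℝ) (j N : ℕ) :
    Set (ℕ → Fin K) :=
  {x ∈ SigmaA M | ∀ n ≥ N, |birk φ n x - a| ≤ 1 / ((j : ℝ) + 1)}

theorem isClosed_closeFrom (hcont : ∀ i, ContinuousOn (φ i) (SigmaA M)) (a : ℝ) (j N : ℕ) :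
    IsClosed (closeFrom M φ a j N) := by
  have h : closeFrom M φ a j N = SigmaA M ∩ ⋂ n, ⋂ (_ : N ≤ n), (SigmaA M ∩
      birk φ n ⁻¹' Metric.closedBall a (1 / ((j : ℝ) + 1))) := by
    ext x
    simp only [closeFrom, mem_ofPred_eq, mem_inter_iff, mem_iInter, mem_preimage,
      Metric.mem_closedBall, Real.dist_eq]
    exact and_congr_right fun hx => forall₂_congr fun n _ => (and_iff_right hx).symm
  rw [h]
  exact (isClosed_SigmaA M).inter <| isClosed_iInter fun n => isClosed_iInter fun _ =>
    (continuousOn_birk hcont n).preimage_isClosed_of_isClosed (isClosed_SigmaA M)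
      Metric.isClosed_closedBall

theorem LAlim_subset_iUnion_closeFrom (a : ℝ) (j : ℕ) :
    LAlim M φ a ⊆ ⋃ N, closeFrom M φ a j N := by
  rintro x ⟨hx, hlim⟩
  obtain ⟨N, hN⟩ := Metric.tendsto_atTop.1 hlim (1 / ((j : ℝ) + 1)) (by positivity)
  exact mem_iUnion.2 ⟨N, hx, fun n hn => (hN n hn).le⟩

theorem uniform_of_iInter_closeFrom (a : ℝ) (N : ℕ → ℕ) {ε : ℝ} (hε : 0 < ε) :
    ∃ n₀ : ℕ, ∀ x ∈ ⋂ j, closeFrom M φ a j (N j), ∀ n ≥ n₀, |birk φ n x - a| < ε := by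
  obtain ⟨j, hj⟩ := exists_nat_one_div_lt hε
  exact ⟨N j, fun x hx n hn => ((mem_iInter.1 hx j).2 n hn).trans_lt hj⟩

end Birkhoff

theorem exists_large_entropy_subset_with_uniform_convergence
    {K : ℕ} (M : Fin K → Fin K → Bool) (hA : ApIrr M)
    (φ : ℕ → (ℕ → Fin K) → ℝ)
    (hcont : ∀ i : ℕ, ContinuousOn (φ i) (SigmaA M))
    (hUDV : UDV M φ)
    (α : ℝ) (hne : LAlim M φ α ≠ ∅) :
    ∀ δ > (0 : ℝ), ∃ Mset : Set (ℕ → Fin K), Mset ≠ ∅ ∧ Mset ⊆ LAlim M φ α ∧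
      htop (LAlim M φ α) - (δ : EReal) < htop Mset ∧
      ∀ ε > (0 : ℝ), ∃ N : ℕ, ∀ x ∈ Mset, ∀ n ≥ N, |birk φ n x - α| < ε := by
  intro δ hδ
  rcases lt_or_ge (htop (LAlim M φ α) - (δ : EReal)) 0 with hneg | hnonneg
  · obtain ⟨x, hx⟩ := nonempty_iff_ne_empty.2 hne
    refine ⟨{x}, singleton_ne_empty x, singleton_subset_iff.2 hx,
      hneg.trans_le (htop_nonneg (singleton_ne_empty x)), fun ε hε => ?_⟩
    obtain ⟨N, hN⟩ := Metric.tendsto_atTop.1 hx.2 ε hε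
    exact ⟨N, fun y hy n hn => (mem_singleton_iff.1 hy) ▸ hN n hn⟩
  · obtain ⟨h, hh⟩ : ∃ h : ℝ, htop (LAlim M φ α) = h := ⟨_, htop_eq_of_nonempty hne⟩
    rw [hh, ← EReal.coe_sub] at hnonneg
    have hnonneg' : 0 ≤ h - δ := EReal.coe_nonneg.1 hnonneg
    have hs : h - δ < h - δ / 2 := by linarith
    have htop_eq : Hentm (LAlim M φ α) (h - δ / 2) = ⊤ := by
      refine Hentm_eq_top_of_lt_htop hne (by linarith) ?_
      rw [hh, EReal.coe_lt_coe_iff]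
      linarith
    obtain ⟨r, hr⟩ : ∃ r, 0 < Hsr (LAlim M φ α) (h - δ / 2) r :=
      lt_iSup_iff.1 (ENNReal.zero_lt_top.trans_eq htop_eq.symm)
    obtain ⟨c, hc, hcr⟩ := exists_between hr
    obtain ⟨N, hN⟩ := exists_le_Hsr_iInter (G := closeFrom M φ α)
      (fun j a b hab x hx => ⟨hx.1, fun n hn => hx.2 n (hab.trans hn)⟩)
      (isClosed_closeFrom hcont α) (LAlim_subset_iUnion_closeFrom α) hcr
    have hne0 : Hsr (⋂ j, closeFrom M φ α j (N j)) (h - δ / 2) r ≠ 0 := (hc.trans_le hN).ne'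
    refine ⟨⋂ j, closeFrom M φ α j (N j), ?_, ?_, ?_,
      fun ε hε => uniform_of_iInter_closeFrom α N hε⟩
    · intro hempty
      rw [hempty, Hsr_empty] at hne0
      exact hne0 rfl
    · intro x hx
      refine ⟨(mem_iInter.1 hx 0).1, Metric.tendsto_atTop.2 fun ε hε => ?_⟩
      obtain ⟨n₀, hn₀⟩ := uniform_of_iInter_closeFrom (M := M) (φ := φ) α N hε
      exact ⟨n₀, fun n hn => hn₀ x hx n hn⟩
    · rw [hh, ← EReal.coe_sub]
      exact (EReal.coe_lt_coe_iff.2 hs).trans_le (le_htop_of_Hsr_ne_zero hne0)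
end
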